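/- arXiv:math/0604265 — 2 statements merged into one kernel-verified Lean document; each statement's English description precedes it below -/
import Mathlib

section
/- Let n ≥ 1 and let u : ℝⁿ → ℝ be a smooth (C²) function which satisfies the gradient bound ‖∇u(x)‖ < 1 for every x ∈ ℝⁿ and which solves the maximal hypersurface (Calabi–Bernstein) equation div( ∇u / √(1 − ‖∇u‖²) ) = 0 on all of ℝⁿ, i.e. ∑_{i=1}^{n} ∂_i ( ∂_i u(x) / √(1 − ‖∇u(x)‖²) ) = 0 for all x. Then u is affine: there exist a linear functional ℓ : ℝⁿ → ℝ and a constant c ∈ ℝ such that u(x) = ℓ(x) + c for all x. -/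
open Filter Topology
open scoped InnerProductSpace

section Algebra

variable {ι : Type*} [Fintype ι] [DecidableEq ι]

theorem sum_sq_column_le_of_trace_eq_zero (D : ι → ι → ℝ) (hsymm : ∀ i j, D i j = D j i)
    (htr : ∑ i, D i i = 0) (o : ι) :
    ∑ i, D i o ^ 2 ≤ Fintype.card ι * ∑ i, ∑ j ∈ Finset.univ.erase o, D i j ^ 2 := by
  set s := Finset.univ.erase o
  have hs : ∀ f : ι → ℝ, ∑ i, f i = f o + ∑ i ∈ s, f i := fun f =>
    (Finset.add_sum_erase _ f (Finset.mem_univ o)).symm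
  have hcard : (s.card : ℝ) + 1 = Fintype.card ι := by
    have := Finset.card_erase_add_one (Finset.mem_univ o)
    exact_mod_cast this
  have h1 : D o o ^ 2 ≤ s.card * ∑ i ∈ s, D i i ^ 2 := by
    have h := sq_sum_le_card_mul_sum_sq (s := s) (f := fun i => D i i)
    have h2 : D o o = -∑ i ∈ s, D i i := by
      have := hs (fun i => D i i)
      linarith
    rw [h2, neg_sq]
    exact h
  have h2 : ∑ i ∈ s, D i i ^ 2 ≤ ∑ i ∈ s, ∑ j ∈ s, D i j ^ 2 :=
    Finset.sum_le_sum fun i hi =>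
      Finset.single_le_sum (f := fun j => D i j ^ 2) (fun j _ => sq_nonneg _) hi
  rw [hs, hs (fun i => ∑ j ∈ s, D i j ^ 2)]
  have h3 : ∑ i ∈ s, D i o ^ 2 = ∑ j ∈ s, D o j ^ 2 :=
    Finset.sum_congr rfl fun i _ => by rw [hsymm]
  rw [h3, ← hcard]
  have h4 : 0 ≤ ∑ j ∈ s, D o j ^ 2 := Finset.sum_nonneg fun _ _ => sq_nonneg _
  have h5 : 0 ≤ ∑ i ∈ s, D i i ^ 2 := Finset.sum_nonneg fun _ _ => sq_nonneg _
  have h6 : (0 : ℝ) ≤ s.card := Nat.cast_nonneg _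
  nlinarith [mul_nonneg h6 h4, mul_le_mul_of_nonneg_left h2 h6]

theorem coupled_trace_inequality (A B : ι → ι → ℝ) (hA : ∀ i j, A i j = A j i)
    (hB : ∀ i j, B i j = B j i) (hAt : ∑ i, A i i = 0) (hBt : ∑ i, B i i = 0)
    (o : ι) {c : ℝ} (hc : 1 ≤ c) :
    (1 + 1 / (2 * Fintype.card ι)) * ((c ^ 2 - 1) * ∑ i, (A i o - B i o) ^ 2) ≤
      c * ∑ i, ∑ j, (c * (A i j ^ 2 + B i j ^ 2) -
        2 * ((if j = o then c else 1) * (A i j * B i j))) := by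
  have hn : (0 : ℝ) < Fintype.card ι := by
    have : Nonempty ι := ⟨o⟩
    exact_mod_cast Fintype.card_pos
  have key := sum_sq_column_le_of_trace_eq_zero (fun i j => A i j - B i j)
    (fun i j => by rw [hA, hB]) (by simp [Finset.sum_sub_distrib, hAt, hBt]) o
  set S1 := ∑ i, (A i o - B i o) ^ 2
  set S2 := ∑ i, ∑ j ∈ Finset.univ.erase o, (A i j - B i j) ^ 2
  have hS1 : 0 ≤ S1 := Finset.sum_nonneg fun _ _ => sq_nonneg _
  have hS2 : c * S1 + (c + 1) / 2 * S2 ≤ ∑ i, ∑ j, (c * (A i j ^ 2 + B i j ^ 2) -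
        2 * ((if j = o then c else 1) * (A i j * B i j))) := by
    rw [Finset.mul_sum, Finset.mul_sum, ← Finset.sum_add_distrib]
    refine Finset.sum_le_sum fun i _ => ?_
    rw [← Finset.add_sum_erase _ _ (Finset.mem_univ o), Finset.mul_sum]
    refine add_le_add ?_ (Finset.sum_le_sum fun j hj => ?_)
    · rw [if_pos rfl]
      apply le_of_eq
      ring
    · rw [if_neg (Finset.ne_of_mem_erase hj)]
      nlinarith [mul_nonneg (sub_nonneg.2 hc) (sq_nonneg (A i j + B i j))]
  have hkey : 1 / (2 * Fintype.card ι) * S1 ≤ S2 / 2 := by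
    rw [div_mul_eq_mul_div, one_mul, div_le_div_iff₀ (by positivity) two_pos]
    linarith
  refine le_trans ?_ (mul_le_mul_of_nonneg_left hS2 (by linarith))
  have h0 : 0 ≤ c ^ 2 - 1 := by nlinarith
  have h1 := mul_le_mul_of_nonneg_left hkey h0
  have h2 : 0 ≤ S2 := le_trans (by positivity) (by linarith : 2 * (1 / (2 * Fintype.card ι) * S1) ≤ S2)
  nlinarith [mul_nonneg (by linarith : (0:ℝ) ≤ c + 1) h2]

end Algebra

theorem second_deriv_nonpos_of_isLocalMax {f f' : ℝ → ℝ} {f'' a : ℝ}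
    (h : IsLocalMax f a) (hf : ∀ᶠ t in 𝓝 a, HasDerivAt f (f' t) t)
    (hf' : HasDerivAt f' f'' a) : f'' ≤ 0 := by
  by_contra! hpos
  have hd : deriv f =ᶠ[𝓝 a] f' := hf.mono fun t ht => ht.deriv
  have hdd : deriv (deriv f) a = f'' := by rw [hd.deriv_eq, hf'.deriv]
  have hmin := isLocalMin_of_deriv_deriv_pos (hdd ▸ hpos) h.deriv_eq_zero
    hf.self_of_nhds.continuousAt
  have hconst : f =ᶠ[𝓝 a] fun _ => f a := by
    filter_upwards [h, hmin] with t h1 h2 using le_antisymm h1 h2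
  have h1 : deriv f =ᶠ[𝓝 a] fun _ => 0 := by
    have := hconst.deriv
    simpa using this
  rw [h1.deriv_eq] at hdd
  simp at hdd
  linarith

section Lorentz

variable {E : Type*} [NormedAddCommGroup E]

/-- The Lorentz factor `1 / √(1 - ‖p‖²)` of a velocity `p`. -/
noncomputable def lorentzFactor (p : E) : ℝ := (√(1 - ‖p‖ ^ 2))⁻¹

theorem one_sub_norm_sq_pos {p : E} (hp : ‖p‖ < 1) : 0 < 1 - ‖p‖ ^ 2 := by
  nlinarith [norm_nonneg p]

theorem lorentzFactor_pos {p : E} (hp : ‖p‖ < 1) : 0 < lorentzFactor p :=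
  inv_pos.2 (Real.sqrt_pos.2 (one_sub_norm_sq_pos hp))

variable [InnerProductSpace ℝ E]

/-- The hyperbolic cosine of the angle between the unit timelike vectors of velocities `p`, `q`. -/
noncomputable def lorentzCosh (p q : E) : ℝ :=
  lorentzFactor p * lorentzFactor q * (1 - ⟪p, q⟫_ℝ)

/-- The gradient of `lorentzCosh` in its first variable. -/
noncomputable def lorentzCoshGrad (p q : E) : E :=
  (lorentzFactor p * lorentzFactor q) • ((lorentzFactor p ^ 2 * (1 - ⟪p, q⟫_ℝ)) • p - q)

/-- The second derivative of `lorentzCosh` at `(p, q)` in the direction `(ξ, η)`. -/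
noncomputable def lorentzCoshHess (p q ξ η : E) : ℝ :=
  (3 * lorentzFactor p ^ 5 * ⟪p, ξ⟫_ℝ ^ 2 + lorentzFactor p ^ 3 * ⟪ξ, ξ⟫_ℝ) *
      lorentzFactor q * (1 - ⟪p, q⟫_ℝ)
    + lorentzFactor p * (3 * lorentzFactor q ^ 5 * ⟪q, η⟫_ℝ ^ 2 + lorentzFactor q ^ 3 * ⟪η, η⟫_ℝ) *
      (1 - ⟪p, q⟫_ℝ)
    - 2 * (lorentzFactor p * lorentzFactor q * ⟪ξ, η⟫_ℝ)
    + 2 * (lorentzFactor p ^ 3 * ⟪p, ξ⟫_ℝ * (lorentzFactor q ^ 3 * ⟪q, η⟫_ℝ) * (1 - ⟪p, q⟫_ℝ))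
    - 2 * ((lorentzFactor p ^ 3 * ⟪p, ξ⟫_ℝ * lorentzFactor q
      + lorentzFactor p * (lorentzFactor q ^ 3 * ⟪q, η⟫_ℝ)) * (⟪ξ, q⟫_ℝ + ⟪p, η⟫_ℝ))

/-- The inverse of the metric induced on a spacelike hyperplane of slope `p`. -/
noncomputable def graphInvMetric (p w : E) : E := w + (lorentzFactor p ^ 2 * ⟪p, w⟫_ℝ) • p

/-- The square root of `graphInvMetric p`. -/
noncomputable def graphFrame (p w : E) : E :=
  w + (lorentzFactor p ^ 2 / (lorentzFactor p + 1) * ⟪p, w⟫_ℝ) • p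

theorem lorentzFactor_sq_mul {p : E} (hp : ‖p‖ < 1) :
    lorentzFactor p ^ 2 * (1 - ⟪p, p⟫_ℝ) = 1 := by
  rw [lorentzFactor, inv_pow, Real.sq_sqrt (one_sub_norm_sq_pos hp).le,
    real_inner_self_eq_norm_sq, inv_mul_cancel₀ (one_sub_norm_sq_pos hp).ne']

theorem one_sub_inner_pos {p q : E} (hp : ‖p‖ < 1) (hq : ‖q‖ < 1) : 0 < 1 - ⟪p, q⟫_ℝ := by
  have := real_inner_le_norm p q
  nlinarith [norm_nonneg p, norm_nonneg q]

theorem lorentzCosh_pos {p q : E} (hp : ‖p‖ < 1) (hq : ‖q‖ < 1) : 0 < lorentzCosh p q :=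
  mul_pos (mul_pos (lorentzFactor_pos hp) (lorentzFactor_pos hq)) (one_sub_inner_pos hp hq)

theorem lorentzCosh_sq_sub_one {p q : E} (hp : ‖p‖ < 1) (hq : ‖q‖ < 1) :
    lorentzCosh p q ^ 2 - 1 =
      lorentzFactor q ^ 2 * ⟪p - q, graphInvMetric p (p - q)⟫_ℝ := by
  have h1 := lorentzFactor_sq_mul hp
  have h2 := lorentzFactor_sq_mul hq
  simp only [lorentzCosh, graphInvMetric, inner_add_right, inner_sub_left, inner_sub_right,
    real_inner_smul_right, real_inner_comm p q]
  generalize lorentzFactor p = N at *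
  generalize lorentzFactor q = M at *
  linear_combination (M ^ 2 * (1 + ⟪p, p⟫_ℝ - 2 * ⟪p, q⟫_ℝ)) * h1 + h2

theorem inner_graphInvMetric_self_nonneg (p w : E) : 0 ≤ ⟪w, graphInvMetric p w⟫_ℝ := by
  have : ⟪w, graphInvMetric p w⟫_ℝ = ⟪w, w⟫_ℝ + (lorentzFactor p * ⟪p, w⟫_ℝ) ^ 2 := by
    simp only [graphInvMetric, inner_add_right, real_inner_smul_right, real_inner_comm w p]
    ring
  rw [this]
  exact add_nonneg real_inner_self_nonneg (sq_nonneg _)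

theorem one_le_lorentzCosh {p q : E} (hp : ‖p‖ < 1) (hq : ‖q‖ < 1) : 1 ≤ lorentzCosh p q := by
  have h := lorentzCosh_sq_sub_one hp hq
  have h1 := mul_nonneg (sq_nonneg (lorentzFactor q)) (inner_graphInvMetric_self_nonneg p (p - q))
  have h2 := lorentzCosh_pos hp hq
  nlinarith

theorem one_lt_lorentzCosh {p q : E} (hp : ‖p‖ < 1) (hq : ‖q‖ < 1) (hpq : p ≠ q) :
    1 < lorentzCosh p q := by
  have h := lorentzCosh_sq_sub_one hp hq
  have h0 : 0 < ⟪p - q, graphInvMetric p (p - q)⟫_ℝ := by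
    have h1 : 0 < ⟪p - q, p - q⟫_ℝ := real_inner_self_pos.2 (sub_ne_zero.2 hpq)
    simp only [graphInvMetric, inner_add_right, real_inner_smul_right, real_inner_comm (p - q) p]
    nlinarith [mul_nonneg (sq_nonneg (lorentzFactor p)) (sq_nonneg ⟪p - q, p⟫_ℝ)]
  have h1 := mul_pos (sq_pos_of_pos (lorentzFactor_pos hq)) h0
  have h2 := lorentzCosh_pos hp hq
  nlinarith

theorem graphFrame_graphFrame {p : E} (hp : ‖p‖ < 1) (w : E) :
    graphFrame p (graphFrame p w) = graphInvMetric p w := by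
  have h1 := lorentzFactor_sq_mul hp
  have h2 := lorentzFactor_pos hp
  simp only [graphFrame, graphInvMetric, inner_add_right, real_inner_smul_right]
  rw [add_assoc, ← add_smul]
  congr 2
  generalize lorentzFactor p = N at *
  field_simp
  linear_combination (-⟪p, w⟫_ℝ) * h1

theorem inner_graphFrame_comm (p v w : E) :
    ⟪graphFrame p v, w⟫_ℝ = ⟪v, graphFrame p w⟫_ℝ := by
  simp only [graphFrame, inner_add_right, inner_add_left, real_inner_smul_right,
    real_inner_smul_left, real_inner_comm p v]
  ring

theorem inner_graphFrame_sub {p : E} (hp : ‖p‖ < 1) (v w : E) :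
    ⟪graphFrame p v, graphFrame p w⟫_ℝ - ⟪p, graphFrame p v⟫_ℝ * ⟪p, graphFrame p w⟫_ℝ
      = ⟪v, w⟫_ℝ := by
  have h1 := lorentzFactor_sq_mul hp
  have h2 := lorentzFactor_pos hp
  simp only [graphFrame, inner_add_right, inner_add_left, real_inner_smul_right,
    real_inner_smul_left, real_inner_comm p v]
  generalize lorentzFactor p = N at *
  generalize ⟪p, p⟫_ℝ = P at *
  have h3 : P = 1 - 1 / N ^ 2 := by field_simp; linarith
  subst h3
  field_simp
  ring

/-- The inverse of `graphFrame p`. -/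
noncomputable def graphCoframe (p w : E) : E :=
  w - (lorentzFactor p / (lorentzFactor p + 1) * ⟪p, w⟫_ℝ) • p

theorem graphFrame_graphCoframe {p : E} (hp : ‖p‖ < 1) (w : E) :
    graphFrame p (graphCoframe p w) = w := by
  have h1 := lorentzFactor_sq_mul hp
  have h2 := lorentzFactor_pos hp
  simp only [graphFrame, graphCoframe, inner_sub_right, real_inner_smul_right]
  rw [sub_add, ← sub_smul, sub_eq_self, smul_eq_zero]
  left
  generalize lorentzFactor p = N at *
  generalize ⟪p, p⟫_ℝ = P at *
  have h3 : P = 1 - 1 / N ^ 2 := by field_simp; linarith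
  subst h3
  field_simp
  ring

theorem sum_inner_graphFrame {ι : Type*} [Fintype ι] {p : E} (hp : ‖p‖ < 1)
    (b : OrthonormalBasis ι ℝ E) (v w : E) :
    ∑ i, ⟪graphFrame p (b i), v⟫_ℝ * ⟪graphFrame p (b i), w⟫_ℝ = ⟪v, graphInvMetric p w⟫_ℝ := by
  simp_rw [inner_graphFrame_comm, real_inner_comm (graphFrame p v) (b _)]
  rw [b.sum_inner_mul_inner, inner_graphFrame_comm, graphFrame_graphFrame hp]

theorem sum_inner_graphFrame_smul {ι : Type*} [Fintype ι] {p : E} (hp : ‖p‖ < 1)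
    (b : OrthonormalBasis ι ℝ E) (w : E) :
    ∑ i, ⟪graphFrame p (b i), w⟫_ℝ • graphFrame p (b i) = graphInvMetric p w := by
  refine ext_inner_left ℝ fun v => ?_
  rw [← sum_inner_graphFrame hp b, inner_sum]
  simp_rw [real_inner_smul_right, real_inner_comm v, mul_comm]

theorem lorentzCoshGrad_eq {p q : E} (hp : ‖p‖ < 1) :
    lorentzCoshGrad p q = (lorentzFactor p * lorentzFactor q) • graphInvMetric p (p - q) := by
  have h1 := lorentzFactor_sq_mul hp
  rw [lorentzCoshGrad, graphInvMetric]
  congr 1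
  have : lorentzFactor p ^ 2 * (1 - ⟪p, q⟫_ℝ) = 1 + lorentzFactor p ^ 2 * ⟪p, p - q⟫_ℝ := by
    rw [inner_sub_right]; linear_combination h1
  rw [this, add_smul, one_smul]
  abel

theorem graphFrame_smul (p : E) (a : ℝ) (w : E) : graphFrame p (a • w) = a • graphFrame p w := by
  simp only [graphFrame, real_inner_smul_right, smul_add, smul_smul]
  ring_nf

theorem exists_coupled_frames [FiniteDimensional ℝ E] {ι : Type*} [Fintype ι] [DecidableEq ι]
    (hcard : Module.finrank ℝ E = Fintype.card ι) (o : ι) {p q : E} (hp : ‖p‖ < 1) (hq : ‖q‖ < 1)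
    (hpq : p ≠ q) :
    ∃ b b' : OrthonormalBasis ι ℝ E,
      (∀ j k, ⟪graphFrame p (b j), graphFrame q (b' k)⟫_ℝ
          - ⟪p, graphFrame p (b j)⟫_ℝ * ⟪q, graphFrame q (b' k)⟫_ℝ =
        if j = k then if k = o then lorentzCosh p q else 1 else 0) ∧
      lorentzFactor q • graphInvMetric p (p - q) =
        √(lorentzCosh p q ^ 2 - 1) • graphFrame p (b o) ∧
      lorentzFactor p • graphInvMetric q (p - q) =
        √(lorentzCosh p q ^ 2 - 1) • graphFrame q (b' o) := by
  have hN := lorentzFactor_pos hp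
  have hM := lorentzFactor_pos hq
  have hc := one_lt_lorentzCosh hp hq hpq
  have hc2 : 0 < lorentzCosh p q ^ 2 - 1 := by nlinarith
  have hs : 0 < √(lorentzCosh p q ^ 2 - 1) := Real.sqrt_pos.2 hc2
  have hss : √(lorentzCosh p q ^ 2 - 1) ^ 2 = lorentzCosh p q ^ 2 - 1 := Real.sq_sqrt hc2.le
  set s := √(lorentzCosh p q ^ 2 - 1)
  set v := p - q with hv
  have hsp : s ^ 2 = lorentzFactor q ^ 2 * ⟪v, graphInvMetric p v⟫_ℝ :=
    hss.trans (lorentzCosh_sq_sub_one hp hq)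
  have hcomm : lorentzCosh q p = lorentzCosh p q := by
    rw [lorentzCosh, lorentzCosh, real_inner_comm p q]; ring
  have hsq : s ^ 2 = lorentzFactor p ^ 2 * ⟪v, graphInvMetric q v⟫_ℝ := by
    rw [hss, ← hcomm, lorentzCosh_sq_sub_one hq hp, ← neg_sub p q, ← hv]
    simp only [graphInvMetric, inner_add_right, inner_neg_left, inner_neg_right,
      real_inner_smul_right]
    ring
  have hunit : ∀ {r : E} {a : ℝ}, ‖r‖ < 1 → s ^ 2 = a ^ 2 * ⟪v, graphInvMetric r v⟫_ℝ →
      ⟪(a / s) • graphFrame r v, (a / s) • graphFrame r v⟫_ℝ = 1 := by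
    intro r a hr h
    rw [real_inner_smul_left, real_inner_smul_right, inner_graphFrame_comm,
      graphFrame_graphFrame hr]
    field_simp
    linarith
  obtain ⟨b, hb⟩ := Orthonormal.exists_orthonormalBasis_extension_of_card_eq (𝕜 := ℝ) hcard
    (v := fun _ : ι => (lorentzFactor q / s) • graphFrame p v) (s := {o}) (by
      refine ⟨fun i => ?_, fun i j hij => (hij (Subsingleton.elim i j)).elim⟩
      have := hunit hp hsp
      rw [real_inner_self_eq_norm_sq] at this
      exact (pow_eq_one_iff_of_nonneg (norm_nonneg _) two_ne_zero).1 this)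
  replace hb := hb o rfl
  have hbo : ∀ k, k ≠ o → ⟪graphFrame p (b k), v⟫_ℝ = 0 := by
    intro k hk
    have h1 : ⟪b k, b o⟫_ℝ = 0 := b.orthonormal.2 hk
    rw [hb, real_inner_smul_right, ← inner_graphFrame_comm] at h1
    exact (mul_eq_zero.1 h1).resolve_left (by positivity)
  have hbo' : ∀ k, k ≠ o → ⟪q, graphFrame p (b k)⟫_ℝ = ⟪p, graphFrame p (b k)⟫_ℝ := by
    intro k hk
    have h1 := hbo k hk
    rw [real_inner_comm, hv, inner_sub_left] at h1
    linarith
  set w : ι → E := fun k => if k = o then (lorentzFactor p / s) • graphFrame q v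
    else graphCoframe q (graphFrame p (b k)) with hw
  have hwo : w o = (lorentzFactor p / s) • graphFrame q v := if_pos rfl
  have hwk : ∀ k, k ≠ o → graphFrame q (w k) = graphFrame p (b k) := fun k hk => by
    simp only [hw, if_neg hk, graphFrame_graphCoframe hq]
  have hw0 : ∀ k, k ≠ o → ⟪w o, w k⟫_ℝ = 0 := fun k hk => by
    rw [hwo, real_inner_smul_left, inner_graphFrame_comm, hwk k hk, real_inner_comm, hbo k hk,
      mul_zero]
  have hworth : Orthonormal ℝ w := by
    rw [orthonormal_iff_ite]
    intro j k
    by_cases hj : j = o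
    · subst hj
      by_cases hk : k = j
      · subst hk
        rw [if_pos rfl, hwo, hunit hq hsq]
      · rw [if_neg (Ne.symm hk), hw0 k hk]
    · by_cases hk : k = o
      · subst hk
        rw [if_neg hj, real_inner_comm, hw0 j hj]
      · rw [← inner_graphFrame_sub hq, hwk j hj, hwk k hk, hbo' j hj, hbo' k hk,
          inner_graphFrame_sub hp, orthonormal_iff_ite.1 b.orthonormal]
  obtain ⟨b', hb'⟩ := Orthonormal.exists_orthonormalBasis_extension_of_card_eq (𝕜 := ℝ) hcard
    (v := w) (s := Set.univ) (hworth.comp _ Subtype.val_injective)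
  replace hb' : ∀ i, b' i = w i := fun i => hb' i (Set.mem_univ i)
  have hao : graphFrame p (b o) = (lorentzFactor q / s) • graphInvMetric p v := by
    rw [← graphFrame_graphFrame hp, hb, graphFrame_smul]
  have hBo : graphFrame q (w o) = (lorentzFactor p / s) • graphInvMetric q v := by
    rw [← graphFrame_graphFrame hq, hwo, graphFrame_smul]
  refine ⟨b, b', fun j k => ?_, ?_, ?_⟩
  · rw [hb']
    by_cases hk : k = o
    · subst hk
      by_cases hj : j = k
      · subst hj
        rw [if_pos rfl, if_pos rfl, hao, hBo]
        simp only [real_inner_smul_left, real_inner_smul_right]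
        have h1 := lorentzFactor_sq_mul hp
        have h2 := lorentzFactor_sq_mul hq
        have h3 : ⟪graphInvMetric p v, graphInvMetric q v⟫_ℝ
            - ⟪p, graphInvMetric p v⟫_ℝ * ⟪q, graphInvMetric q v⟫_ℝ
            = (1 - ⟪p, q⟫_ℝ) * s ^ 2 := by
          rw [hss]
          simp only [hv, lorentzCosh, graphInvMetric, inner_add_right, inner_add_left,
            inner_sub_left, inner_sub_right, real_inner_smul_right, real_inner_smul_left,
            real_inner_comm p q]
          generalize lorentzFactor p = N at *
          generalize lorentzFactor q = M at *
          generalize ⟪p, p⟫_ℝ = P at *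
          generalize ⟪q, q⟫_ℝ = Q at *
          have h3 : P = 1 - 1 / N ^ 2 := by field_simp; linarith
          have h4 : Q = 1 - 1 / M ^ 2 := by field_simp; linarith
          subst h3 h4
          field_simp
          ring
        rw [lorentzCosh]
        field_simp
        linear_combination h3
      · rw [if_neg hj, ← hbo' j hj, ← hwk j hj, inner_graphFrame_sub hq,
          real_inner_comm, hw0 j hj]
    · rw [hwk k hk, hbo' k hk, inner_graphFrame_sub hp, orthonormal_iff_ite.1 b.orthonormal,
        if_neg hk]
  · rw [hao, smul_smul, mul_div_cancel₀ _ hs.ne']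
  · rw [hb', hBo, smul_smul, mul_div_cancel₀ _ hs.ne']

theorem hasDerivAt_lorentzFactor {P : ℝ → E} {P' : E} {t : ℝ} (hP : HasDerivAt P P' t)
    (h : ‖P t‖ < 1) :
    HasDerivAt (fun t => lorentzFactor (P t)) (lorentzFactor (P t) ^ 3 * ⟪P t, P'⟫_ℝ) t := by
  have h0 := one_sub_norm_sq_pos h
  have h1 := (((hP.norm_sq).const_sub 1).sqrt h0.ne').inv (Real.sqrt_pos.2 h0).ne'
  refine h1.congr_deriv ?_
  rw [lorentzFactor]
  have := Real.sqrt_pos.2 h0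
  field_simp

theorem inner_lorentzCoshGrad (p q ξ η : E) :
    ⟪lorentzCoshGrad p q, ξ⟫_ℝ + ⟪lorentzCoshGrad q p, η⟫_ℝ =
      (lorentzFactor p ^ 3 * ⟪p, ξ⟫_ℝ * lorentzFactor q
        + lorentzFactor p * (lorentzFactor q ^ 3 * ⟪q, η⟫_ℝ)) * (1 - ⟪p, q⟫_ℝ)
      - lorentzFactor p * lorentzFactor q * (⟪p, η⟫_ℝ + ⟪ξ, q⟫_ℝ) := by
  simp only [lorentzCoshGrad, inner_sub_left, real_inner_smul_left, real_inner_comm p q,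
    real_inner_comm q ξ]
  ring

theorem hasDerivAt_lorentzCosh {P Q : ℝ → E} {P' Q' : E} {t : ℝ} (hP : HasDerivAt P P' t)
    (hQ : HasDerivAt Q Q' t) (hp : ‖P t‖ < 1) (hq : ‖Q t‖ < 1) :
    HasDerivAt (fun t => lorentzCosh (P t) (Q t))
      (⟪lorentzCoshGrad (P t) (Q t), P'⟫_ℝ + ⟪lorentzCoshGrad (Q t) (P t), Q'⟫_ℝ) t := by
  refine (((hasDerivAt_lorentzFactor hP hp).mul (hasDerivAt_lorentzFactor hQ hq)).mul
    ((hP.inner ℝ hQ).const_sub 1)).congr_deriv ?_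
  rw [inner_lorentzCoshGrad, Pi.mul_apply]
  ring

theorem hasDerivAt_inner_lorentzCoshGrad {P Q P' Q' : ℝ → E} {P'' Q'' : E} {t : ℝ}
    (hP : HasDerivAt P (P' t) t) (hQ : HasDerivAt Q (Q' t) t)
    (hP' : HasDerivAt P' P'' t) (hQ' : HasDerivAt Q' Q'' t)
    (hp : ‖P t‖ < 1) (hq : ‖Q t‖ < 1) :
    HasDerivAt (fun t => ⟪lorentzCoshGrad (P t) (Q t), P' t⟫_ℝ
        + ⟪lorentzCoshGrad (Q t) (P t), Q' t⟫_ℝ)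
      (⟪lorentzCoshGrad (P t) (Q t), P''⟫_ℝ + ⟪lorentzCoshGrad (Q t) (P t), Q''⟫_ℝ
        + lorentzCoshHess (P t) (Q t) (P' t) (Q' t)) t := by
  simp only [inner_lorentzCoshGrad]
  have hN := hasDerivAt_lorentzFactor hP hp
  have hM := hasDerivAt_lorentzFactor hQ hq
  have h1 := ((hN.pow 3).mul (hP.inner ℝ hP')).mul hM
  have h2 := hN.mul ((hM.pow 3).mul (hQ.inner ℝ hQ'))
  have h3 := (h1.add h2).mul ((hP.inner ℝ hQ).const_sub 1)
  have h4 := (hN.mul hM).mul ((hP.inner ℝ hQ').add (hP'.inner ℝ hQ))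
  refine (h3.sub h4).congr_deriv ?_
  simp only [lorentzCoshHess, Pi.mul_apply, Pi.add_apply, Pi.pow_apply]
  ring

theorem lorentzCoshHess_add_eq {p q : E} (hp : ‖p‖ < 1) (hq : ‖q‖ < 1) (ξ η : E) :
    ⟪lorentzCoshGrad p q, (-(2 * lorentzFactor p ^ 2 * ⟪p, ξ⟫_ℝ)) • ξ⟫_ℝ
      + ⟪lorentzCoshGrad q p, (-(2 * lorentzFactor q ^ 2 * ⟪q, η⟫_ℝ)) • η⟫_ℝ
      + lorentzCoshHess p q ξ η =
    lorentzCosh p q * (lorentzFactor p ^ 2 * ⟪ξ, graphInvMetric p ξ⟫_ℝ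
      + lorentzFactor q ^ 2 * ⟪η, graphInvMetric q η⟫_ℝ)
    - 2 * (lorentzFactor p * lorentzFactor q *
      (⟪graphInvMetric p ξ, graphInvMetric q η⟫_ℝ
        - ⟪p, graphInvMetric p ξ⟫_ℝ * ⟪q, graphInvMetric q η⟫_ℝ)) := by
  have h1 := lorentzFactor_sq_mul hp
  have h2 := lorentzFactor_sq_mul hq
  have hN := lorentzFactor_pos hp
  have hM := lorentzFactor_pos hq
  rw [inner_lorentzCoshGrad]
  simp only [lorentzCosh, lorentzCoshHess, graphInvMetric, inner_add_right, inner_add_left,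
    real_inner_smul_right, real_inner_smul_left, real_inner_comm p ξ, real_inner_comm q η,
    real_inner_comm q ξ]
  generalize lorentzFactor p = N at *
  generalize lorentzFactor q = M at *
  generalize ⟪p, p⟫_ℝ = P at *
  generalize ⟪q, q⟫_ℝ = Q at *
  have h3 : P = 1 - 1 / N ^ 2 := by field_simp; linarith
  have h4 : Q = 1 - 1 / M ^ 2 := by field_simp; linarith
  subst h3 h4
  field_simp
  ring

theorem sum_coupled_frames {ι : Type*} [Fintype ι] [DecidableEq ι] (o : ι) {p q : E}
    (hp : ‖p‖ < 1) (hq : ‖q‖ < 1) {b b' : OrthonormalBasis ι ℝ E} {c : ℝ}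
    (hb : ∀ j k, ⟪graphFrame p (b j), graphFrame q (b' k)⟫_ℝ
          - ⟪p, graphFrame p (b j)⟫_ℝ * ⟪q, graphFrame q (b' k)⟫_ℝ =
        if j = k then if k = o then c else 1 else 0) :
    ∑ i, (⟪graphFrame p (b i) - graphFrame q (b' i), graphFrame p (b i) - graphFrame q (b' i)⟫_ℝ
      - (⟪p, graphFrame p (b i)⟫_ℝ - ⟪q, graphFrame q (b' i)⟫_ℝ) ^ 2) = 2 * (1 - c) := by
  have h : ∀ i, ⟪graphFrame p (b i) - graphFrame q (b' i), graphFrame p (b i) - graphFrame q (b' i)⟫_ℝ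
      - (⟪p, graphFrame p (b i)⟫_ℝ - ⟪q, graphFrame q (b' i)⟫_ℝ) ^ 2
      = if i = o then 2 * (1 - c) else 0 := by
    intro i
    have h1 := inner_graphFrame_sub hp (b i) (b i)
    have h2 := inner_graphFrame_sub hq (b' i) (b' i)
    have h3 := hb i i
    rw [if_pos rfl] at h3
    rw [real_inner_self_eq_norm_sq (b i), b.norm_eq_one] at h1
    rw [real_inner_self_eq_norm_sq (b' i), b'.norm_eq_one] at h2
    rw [inner_sub_left, inner_sub_right, inner_sub_right,
      real_inner_comm (graphFrame p (b i)) (graphFrame q (b' i))]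
    split_ifs at h3 ⊢ <;> linear_combination h1 + h2 - 2 * h3
  rw [Finset.sum_congr rfl fun i _ => h i]
  simp

theorem lorentzCosh_coupled_subharmonic {ι : Type*} [Fintype ι] [DecidableEq ι] (o : ι) {p q : E}
    (hp : ‖p‖ < 1) (hq : ‖q‖ < 1) {b b' : OrthonormalBasis ι ℝ E}
    (hb : ∀ j k, ⟪graphFrame p (b j), graphFrame q (b' k)⟫_ℝ
          - ⟪p, graphFrame p (b j)⟫_ℝ * ⟪q, graphFrame q (b' k)⟫_ℝ =
        if j = k then if k = o then lorentzCosh p q else 1 else 0)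
    (hbo : lorentzFactor q • graphInvMetric p (p - q) =
        √(lorentzCosh p q ^ 2 - 1) • graphFrame p (b o))
    (hbo' : lorentzFactor p • graphInvMetric q (p - q) =
        √(lorentzCosh p q ^ 2 - 1) • graphFrame q (b' o))
    {H K : E →L[ℝ] E} (hH : ∀ v w, ⟪H v, w⟫_ℝ = ⟪v, H w⟫_ℝ) (hK : ∀ v w, ⟪K v, w⟫_ℝ = ⟪v, K w⟫_ℝ)
    (hHt : ∑ i, ⟪H (graphFrame p (b i)), graphFrame p (b i)⟫_ℝ = 0)
    (hKt : ∑ i, ⟪K (graphFrame q (b' i)), graphFrame q (b' i)⟫_ℝ = 0) {r s : E}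
    (hr : r = ∑ i, (-(2 * lorentzFactor p ^ 2 * ⟪p, H (graphFrame p (b i))⟫_ℝ)) •
      H (graphFrame p (b i)))
    (hs : s = ∑ i, (-(2 * lorentzFactor q ^ 2 * ⟪q, K (graphFrame q (b' i))⟫_ℝ)) •
      K (graphFrame q (b' i))) :
    (1 + 1 / (2 * Fintype.card ι)) * ∑ i, (⟪lorentzCoshGrad p q, H (graphFrame p (b i))⟫_ℝ
        + ⟪lorentzCoshGrad q p, K (graphFrame q (b' i))⟫_ℝ) ^ 2 ≤
      lorentzCosh p q * (⟪lorentzCoshGrad p q, r⟫_ℝ + ⟪lorentzCoshGrad q p, s⟫_ℝ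
        + ∑ i, lorentzCoshHess p q (H (graphFrame p (b i))) (K (graphFrame q (b' i)))) := by
  have hc := one_le_lorentzCosh hp hq
  have hss : √(lorentzCosh p q ^ 2 - 1) ^ 2 = lorentzCosh p q ^ 2 - 1 :=
    Real.sq_sqrt (by nlinarith)
  set ξ := fun i => H (graphFrame p (b i)) with hξ
  set η := fun i => K (graphFrame q (b' i)) with hη
  set A : ι → ι → ℝ := fun i j => lorentzFactor p * ⟪graphFrame p (b j), ξ i⟫_ℝ with hA
  set B : ι → ι → ℝ := fun i j => lorentzFactor q * ⟪graphFrame q (b' j), η i⟫_ℝ with hB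
  have key := coupled_trace_inequality A B
    (fun i j => by simp only [hA, hξ]; rw [← hH, real_inner_comm])
    (fun i j => by simp only [hB, hη]; rw [← hK, real_inner_comm])
    (by
      simp only [hA, hξ]
      rw [← Finset.mul_sum, Finset.sum_congr rfl fun i _ => real_inner_comm _ _, hHt, mul_zero])
    (by
      simp only [hB, hη]
      rw [← Finset.mul_sum, Finset.sum_congr rfl fun i _ => real_inner_comm _ _, hKt, mul_zero]) o hc
  convert key using 1
  · congr 1
    rw [Finset.mul_sum]
    refine Finset.sum_congr rfl fun i _ => ?_
    have h1 : ⟪lorentzCoshGrad p q, ξ i⟫_ℝ = √(lorentzCosh p q ^ 2 - 1) * A i o := by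
      rw [lorentzCoshGrad_eq hp, mul_smul, hbo, real_inner_smul_left, real_inner_smul_left]
      simp only [hA]
      ring
    have h2 : ⟪lorentzCoshGrad q p, η i⟫_ℝ = -(√(lorentzCosh p q ^ 2 - 1) * B i o) := by
      have : graphInvMetric q (q - p) = -graphInvMetric q (p - q) := by
        rw [← neg_sub p q]
        simp only [graphInvMetric, inner_neg_right, mul_neg, neg_smul, neg_add]
      rw [lorentzCoshGrad_eq hq, this, smul_neg, mul_smul, hbo', inner_neg_left,
        real_inner_smul_left, real_inner_smul_left]
      simp only [hB]
      ring
    change (⟪lorentzCoshGrad p q, ξ i⟫_ℝ + ⟪lorentzCoshGrad q p, η i⟫_ℝ) ^ 2 = _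
    rw [h1, h2]
    linear_combination (A i o - B i o) ^ 2 * hss
  · rw [hr, hs, inner_sum, inner_sum, ← Finset.sum_add_distrib, ← Finset.sum_add_distrib]
    congr 1
    refine Finset.sum_congr rfl fun i _ => ?_
    rw [lorentzCoshHess_add_eq hp hq, Finset.sum_sub_distrib, ← Finset.mul_sum, ← Finset.mul_sum,
      Finset.sum_add_distrib]
    congr 1
    · rw [← sum_inner_graphFrame hp b, ← sum_inner_graphFrame hq b', Finset.mul_sum,
        Finset.mul_sum]
      congr 2 <;> refine Finset.sum_congr rfl fun j _ => ?_
      · simp only [hA, hξ]; ring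
      · simp only [hB, hη]; ring
    · have h1 : ⟪graphInvMetric p (ξ i), graphInvMetric q (η i)⟫_ℝ
          - ⟪p, graphInvMetric p (ξ i)⟫_ℝ * ⟪q, graphInvMetric q (η i)⟫_ℝ =
          ∑ j, ∑ k, ⟪graphFrame p (b j), ξ i⟫_ℝ * ⟪graphFrame q (b' k), η i⟫_ℝ *
            (⟪graphFrame p (b j), graphFrame q (b' k)⟫_ℝ
              - ⟪p, graphFrame p (b j)⟫_ℝ * ⟪q, graphFrame q (b' k)⟫_ℝ) := by
        rw [← sum_inner_graphFrame_smul hp b, ← sum_inner_graphFrame_smul hq b']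
        rw [sum_inner]
        simp only [inner_sum, real_inner_smul_left, real_inner_smul_right]
        rw [Finset.sum_mul_sum, ← Finset.sum_sub_distrib]
        refine Finset.sum_congr rfl fun j _ => ?_
        rw [← Finset.sum_sub_distrib]
        refine Finset.sum_congr rfl fun k _ => ?_
        ring
      change 2 * (_ * (⟪graphInvMetric p (ξ i), graphInvMetric q (η i)⟫_ℝ
          - ⟪p, graphInvMetric p (ξ i)⟫_ℝ * ⟪q, graphInvMetric q (η i)⟫_ℝ)) = _
      rw [h1]
      simp only [hb, mul_ite, mul_zero, Finset.sum_ite_eq, Finset.mem_univ, if_true, mul_one]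
      rw [Finset.mul_sum]
      congr 1
      refine Finset.sum_congr rfl fun j _ => ?_
      simp only [hA, hB]
      split_ifs <;> ring

end Lorentz

section DifferenceQuotient

variable {F G : Type*} [NormedAddCommGroup F] [NormedSpace ℝ F] [NormedAddCommGroup G]
  [NormedSpace ℝ G]

theorem HasStrictFDerivAt.tendsto_inv_smul_sub {f : F → G} {f' : F →L[ℝ] G} {x : F}
    (hf : HasStrictFDerivAt f f' x) {α : Type*} {l : Filter α} {h : α → ℝ} {X : α → F}
    (hh : Tendsto h l (𝓝[≠] 0)) (hX : Tendsto X l (𝓝 x)) (v : F) :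
    Tendsto (fun a => (h a)⁻¹ • (f (X a + h a • v) - f (X a))) l (𝓝 (f' v)) := by
  have hh0 : Tendsto h l (𝓝 0) := hh.mono_right nhdsWithin_le_nhds
  have hY : Tendsto (fun a => X a + h a • v) l (𝓝 x) := by
    simpa using hX.add (hh0.smul_const v)
  have h1 := hf.isLittleO.comp_tendsto (hY.prodMk_nhds hX)
  have h2 : (fun a => f (X a + h a • v) - f (X a) - f' (h a • v)) =o[l] h := by
    refine (h1.congr (fun a => by simp) (fun a => ?_)).trans_isBigO
      (g := fun a => h a • v) ?_
    · simp
    · exact Asymptotics.IsBigO.of_bound ‖v‖ (Eventually.of_forall fun a => by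
        rw [norm_smul, mul_comm])
  have h3 := h2.tendsto_inv_smul_nhds_zero.add_const (f' v)
  rw [zero_add] at h3
  refine h3.congr' ?_
  filter_upwards [hh self_mem_nhdsWithin] with a ha
  have ha : h a ≠ 0 := ha
  rw [smul_sub, map_smul, inv_smul_smul₀ ha, sub_add_cancel]

end DifferenceQuotient

section Lorentz

variable {E : Type*} [NormedAddCommGroup E] [InnerProductSpace ℝ E]

theorem hasStrictFDerivAt_lorentzFactor {p : E} (hp : ‖p‖ < 1) :
    HasStrictFDerivAt lorentzFactor (lorentzFactor p ^ 3 • innerSL ℝ p) p := by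
  have h0 := one_sub_norm_sq_pos hp
  have h1 := (hasStrictDerivAt_inv (Real.sqrt_pos.2 h0).ne').comp_hasStrictFDerivAt p
    (((hasStrictFDerivAt_norm_sq p).const_sub 1).sqrt h0.ne')
  refine h1.congr_fderiv ?_
  ext v
  have := Real.sqrt_pos.2 h0
  simp [lorentzFactor]
  field_simp

theorem sum_inner_apply_graphFrame {ι : Type*} [Fintype ι] {p : E} (hp : ‖p‖ < 1)
    (b e : OrthonormalBasis ι ℝ E) (A : E →L[ℝ] E) :
    ∑ i, ⟪A (graphFrame p (b i)), graphFrame p (b i)⟫_ℝ =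
      ∑ k, ⟪e k, A (e k)⟫_ℝ + lorentzFactor p ^ 2 * ⟪p, A p⟫_ℝ := by
  have h1 : ∀ w, ⟪A w, w⟫_ℝ = ∑ k, ⟪w, e k⟫_ℝ * ⟪w, A (e k)⟫_ℝ := fun w => by
    conv_lhs => rw [← e.sum_repr' w]
    rw [map_sum, sum_inner]
    refine Finset.sum_congr rfl fun k _ => ?_
    rw [e.sum_repr' w, map_smul, real_inner_smul_left, real_inner_comm (e k),
      real_inner_comm (A (e k))]
  have h2 : ⟪p, A p⟫_ℝ = ∑ k, ⟪e k, p⟫_ℝ * ⟪p, A (e k)⟫_ℝ := by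
    conv_lhs => rw [← e.sum_repr' p, map_sum]
    rw [e.sum_repr' p, inner_sum]
    simp only [map_smul, real_inner_smul_right]
  simp_rw [h1]
  rw [Finset.sum_comm, h2, Finset.mul_sum, ← Finset.sum_add_distrib]
  refine Finset.sum_congr rfl fun k _ => ?_
  rw [sum_inner_graphFrame hp, graphInvMetric, inner_add_right, real_inner_smul_right]
  ring

/-- `u` is an entire function of class `C²` with gradient `g` and Hessian `H`, whose graph is
spacelike and maximal. -/
structure IsEntireMaximal {ι : Type*} [Fintype ι] (e : OrthonormalBasis ι ℝ E) (u : E → ℝ)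
    (g : E → E) (H : E → E →L[ℝ] E) : Prop where
  hasFDerivAt : ∀ x, HasFDerivAt u (innerSL ℝ (g x)) x
  hasFDerivAt_grad : ∀ x, HasFDerivAt g (H x) x
  continuous_hess : Continuous H
  symm : ∀ x v w, ⟪H x v, w⟫_ℝ = ⟪v, H x w⟫_ℝ
  norm_grad_lt : ∀ x, ‖g x‖ < 1
  trace_eq : ∀ x, ∑ k, ⟪e k, H x (e k)⟫_ℝ + lorentzFactor (g x) ^ 2 * ⟪g x, H x (g x)⟫_ℝ = 0

namespace IsEntireMaximal

variable {ι : Type*} [Fintype ι] {e : OrthonormalBasis ι ℝ E} {u : E → ℝ} {g : E → E}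
  {H : E → E →L[ℝ] E}

theorem continuous_grad (hu : IsEntireMaximal e u g H) : Continuous g :=
  continuous_iff_continuousAt.2 fun x => (hu.hasFDerivAt_grad x).continuousAt

theorem continuous (hu : IsEntireMaximal e u g H) : Continuous u :=
  continuous_iff_continuousAt.2 fun x => (hu.hasFDerivAt x).continuousAt

theorem hasStrictFDerivAt (hu : IsEntireMaximal e u g H) (x : E) :
    HasStrictFDerivAt u (innerSL ℝ (g x)) x :=
  hasStrictFDerivAt_of_hasFDerivAt_of_continuousAt (f' := fun x => innerSL ℝ (g x))
    (Eventually.of_forall hu.hasFDerivAt)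
    ((innerSL ℝ).continuous.comp hu.continuous_grad).continuousAt

theorem hasStrictFDerivAt_grad (hu : IsEntireMaximal e u g H) (x : E) :
    HasStrictFDerivAt g (H x) x :=
  hasStrictFDerivAt_of_hasFDerivAt_of_continuousAt
    (Eventually.of_forall hu.hasFDerivAt_grad) hu.continuous_hess.continuousAt

theorem trace_graphFrame_eq_zero (hu : IsEntireMaximal e u g H) (x : E)
    (b : OrthonormalBasis ι ℝ E) :
    ∑ i, ⟪H x (graphFrame (g x) (b i)), graphFrame (g x) (b i)⟫_ℝ = 0 := by
  rw [sum_inner_apply_graphFrame (hu.norm_grad_lt x) b e, hu.trace_eq]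

theorem hasStrictFDerivAt_factor_smul (hu : IsEntireMaximal e u g H) (x : E) :
    HasStrictFDerivAt (fun x => lorentzFactor (g x) • g x)
      (lorentzFactor (g x) • H x +
        ((lorentzFactor (g x) ^ 3 • innerSL ℝ (g x)).comp (H x)).smulRight (g x)) x :=
  ((hasStrictFDerivAt_lorentzFactor (hu.norm_grad_lt x)).comp x
    (hu.hasStrictFDerivAt_grad x)).smul (hu.hasStrictFDerivAt_grad x)

/-- The equation at `y`, tested against the frame at `x`. -/
theorem sum_inner_apply_graphFrame_eq (hu : IsEntireMaximal e u g H) (x y : E)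
    (b : OrthonormalBasis ι ℝ E) :
    ∑ i, ⟪H y (graphFrame (g x) (b i)), graphFrame (g x) (b i)⟫_ℝ =
      -⟪lorentzFactor (g y) • g y - lorentzFactor (g x) • g x,
        H y (lorentzFactor (g x) • g x + lorentzFactor (g y) • g y)⟫_ℝ := by
  have h1 := sum_inner_apply_graphFrame (hu.norm_grad_lt x) b e (H y)
  have h2 := hu.trace_eq y
  have h3 := hu.symm y (g x) (g y)
  rw [real_inner_comm] at h3
  rw [h1]
  simp only [inner_sub_left, inner_add_right, map_add, map_smul, real_inner_smul_left,
    real_inner_smul_right]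
  linear_combination h2 + lorentzFactor (g x) * lorentzFactor (g y) * h3

end IsEntireMaximal

end Lorentz

section GradQuot

variable {E : Type*} [NormedAddCommGroup E] [InnerProductSpace ℝ E] {ι : Type*} [Fintype ι]

/-- The difference quotient approximating the gradient of `f` in the frame `e`. -/
noncomputable def gradQuot (e : OrthonormalBasis ι ℝ E) (f : E → ℝ) (h : ℝ) (x : E) : E :=
  ∑ k, (h⁻¹ * (f (x + h • e k) - f x)) • e k

variable {e : OrthonormalBasis ι ℝ E}

theorem continuous_gradQuot {f : E → ℝ} (hf : Continuous f) (h : ℝ) :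
    Continuous (gradQuot e f h) := by
  unfold gradQuot
  fun_prop

theorem hasDerivAt_gradQuot_line {f f' : E → ℝ} {a : E}
    (hf : ∀ y t, HasDerivAt (fun t : ℝ => f (y + t • a)) (f' (y + t • a)) t) (h : ℝ) (x : E)
    (t : ℝ) :
    HasDerivAt (fun t : ℝ => gradQuot e f h (x + t • a)) (gradQuot e f' h (x + t • a)) t := by
  refine HasDerivAt.fun_sum fun k _ => HasDerivAt.smul_const ?_ _
  refine HasDerivAt.const_mul _ (HasDerivAt.sub ?_ (hf x t))
  have := hf (x + h • e k) t
  simpa only [add_right_comm] using this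

theorem sum_gradQuot {κ : Type*} (s : Finset κ) (f : κ → E → ℝ) (h : ℝ) (x : E) :
    ∑ i ∈ s, gradQuot e (f i) h x = gradQuot e (fun y => ∑ i ∈ s, f i y) h x := by
  simp only [gradQuot]
  rw [Finset.sum_comm]
  refine Finset.sum_congr rfl fun k _ => ?_
  rw [← Finset.sum_smul, ← Finset.mul_sum, Finset.sum_sub_distrib]

namespace IsEntireMaximal

variable {u : E → ℝ} {g : E → E} {H : E → E →L[ℝ] E}

theorem hasDerivAt_line (hu : IsEntireMaximal e u g H) (a x : E) (t : ℝ) :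
    HasDerivAt (fun t : ℝ => u (x + t • a)) ⟪g (x + t • a), a⟫_ℝ t := by
  have h1 : HasDerivAt (fun t : ℝ => x + t • a) a t := by
    simpa using ((hasDerivAt_id t).smul_const a).const_add x
  exact (hu.hasFDerivAt (x + t • a)).comp_hasDerivAt t h1

theorem hasDerivAt_grad_line (hu : IsEntireMaximal e u g H) (a x : E) (t : ℝ) :
    HasDerivAt (fun t : ℝ => ⟪g (x + t • a), a⟫_ℝ) ⟪H (x + t • a) a, a⟫_ℝ t := by
  have h1 : HasDerivAt (fun t : ℝ => x + t • a) a t := by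
    simpa using ((hasDerivAt_id t).smul_const a).const_add x
  have h2 := (hu.hasFDerivAt_grad (x + t • a)).comp_hasDerivAt t h1
  simpa using h2.inner ℝ (hasDerivAt_const t a)

variable {α : Type*} {l : Filter α} {h : α → ℝ} {X : α → E} {x : E}

theorem tendsto_gradQuot (hu : IsEntireMaximal e u g H) (hh : Tendsto h l (𝓝[≠] 0))
    (hX : Tendsto X l (𝓝 x)) :
    Tendsto (fun a => gradQuot e u (h a) (X a)) l (𝓝 (g x)) := by
  have h1 : Tendsto (fun a => gradQuot e u (h a) (X a)) l (𝓝 (∑ k, ⟪g x, e k⟫_ℝ • e k)) :=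
    tendsto_finsetSum _ fun k _ =>
      ((hu.hasStrictFDerivAt x).tendsto_inv_smul_sub hh hX (e k)).smul_const _
  simp_rw [real_inner_comm (e _)] at h1
  rwa [e.sum_repr'] at h1

theorem tendsto_gradQuot_grad (hu : IsEntireMaximal e u g H) (hh : Tendsto h l (𝓝[≠] 0))
    (hX : Tendsto X l (𝓝 x)) {V : α → E} {v : E} (hV : Tendsto V l (𝓝 v)) :
    Tendsto (fun a => gradQuot e (fun y => ⟪g y, V a⟫_ℝ) (h a) (X a)) l (𝓝 (H x v)) := by
  have h1 : Tendsto (fun a => gradQuot e (fun y => ⟪g y, V a⟫_ℝ) (h a) (X a)) l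
      (𝓝 (∑ k, ⟪H x (e k), v⟫_ℝ • e k)) := by
    refine tendsto_finsetSum _ fun k _ => Tendsto.smul_const ?_ _
    have := ((hu.hasStrictFDerivAt_grad x).tendsto_inv_smul_sub hh hX (e k)).inner (𝕜 := ℝ) hV
    simpa only [real_inner_smul_left, inner_sub_left] using this
  simp_rw [hu.symm] at h1
  rwa [e.sum_repr'] at h1

theorem tendsto_gradQuot_hess (hu : IsEntireMaximal e u g H) (hh : Tendsto h l (𝓝[≠] 0))
    (hX : Tendsto X l (𝓝 x)) (b : OrthonormalBasis ι ℝ E) :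
    Tendsto (fun a => ∑ i, gradQuot e (fun y => ⟪H y (graphFrame (g (X a)) (b i)),
        graphFrame (g (X a)) (b i)⟫_ℝ) (h a) (X a)) l
      (𝓝 (∑ i, (-(2 * lorentzFactor (g x) ^ 2 * ⟪g x, H x (graphFrame (g x) (b i))⟫_ℝ)) •
        H x (graphFrame (g x) (b i)))) := by
  have hp := hu.norm_grad_lt x
  set ν : E → E := fun x => lorentzFactor (g x) • g x with hν
  set ν' : E →L[ℝ] E := lorentzFactor (g x) • H x +
        ((lorentzFactor (g x) ^ 3 • innerSL ℝ (g x)).comp (H x)).smulRight (g x) with hν'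
  have hd : HasStrictFDerivAt ν ν' x := hu.hasStrictFDerivAt_factor_smul x
  have hh0 : Tendsto h l (𝓝 0) := hh.mono_right nhdsWithin_le_nhds
  have hνX : Tendsto (fun a => ν (X a)) l (𝓝 (ν x)) := hd.continuousAt.tendsto.comp hX
  have h1 : Tendsto (fun a => ∑ k, (-⟪(h a)⁻¹ • (ν (X a + h a • e k) - ν (X a)),
      H (X a + h a • e k) (ν (X a) + ν (X a + h a • e k))⟫_ℝ) • e k) l
      (𝓝 (∑ k, (-⟪ν' (e k), H x (ν x + ν x)⟫_ℝ) • e k)) := by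
    refine tendsto_finsetSum _ fun k _ => Tendsto.smul_const (Tendsto.neg ?_) _
    have hY : Tendsto (fun a => X a + h a • e k) l (𝓝 x) := by
      simpa using hX.add (hh0.smul_const (e k))
    refine (hd.tendsto_inv_smul_sub hh hX (e k)).inner ?_
    exact (isBoundedBilinearMap_apply.continuous.tendsto (H x, ν x + ν x)).comp
      (((hu.continuous_hess.tendsto x).comp hY).prodMk_nhds
        (hνX.add (hd.continuousAt.tendsto.comp hY)))
  have h2 : ∑ i, (-(2 * lorentzFactor (g x) ^ 2 * ⟪g x, H x (graphFrame (g x) (b i))⟫_ℝ)) •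
        H x (graphFrame (g x) (b i)) = ∑ k, (-⟪ν' (e k), H x (ν x + ν x)⟫_ℝ) • e k := by
    have h3 : ∀ k, -⟪ν' (e k), H x (ν x + ν x)⟫_ℝ = ⟪e k, -(2 * lorentzFactor (g x) ^ 2) •
        H x (graphInvMetric (g x) (H x (g x)))⟫_ℝ := fun k => by
      simp only [hν', hν, graphInvMetric, add_apply, smul_apply,
        ContinuousLinearMap.smulRight_apply,
        ContinuousLinearMap.comp_apply, innerSL_apply_apply, inner_add_left, inner_add_right,
        real_inner_smul_left, real_inner_smul_right, map_add, map_smul, hu.symm, smul_eq_mul]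
      have h4 := hu.symm x (g x) (e k)
      rw [real_inner_comm (e k)] at h4
      rw [h4]
      ring
    simp_rw [h3]
    rw [e.sum_repr', ← sum_inner_graphFrame_smul hp b, map_sum, Finset.smul_sum]
    refine Finset.sum_congr rfl fun i _ => ?_
    rw [map_smul, smul_smul, ← hu.symm, real_inner_comm]
    congr 1
    ring
  rw [h2]
  refine h1.congr fun a => ?_
  · rw [sum_gradQuot, gradQuot]
    refine Finset.sum_congr rfl fun k _ => ?_
    rw [hu.trace_graphFrame_eq_zero, sub_zero, hu.sum_inner_apply_graphFrame_eq,
      real_inner_smul_left]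
    simp only [hν]
    ring_nf

end IsEntireMaximal

end GradQuot

section Penalty

variable {E : Type*} [NormedAddCommGroup E] [InnerProductSpace ℝ E]

/-- The squared Lorentzian distance between two points of the graph of `u`. -/
noncomputable def graphSepSq (u : E → ℝ) (x y : E) : ℝ := ‖x - y‖ ^ 2 - (u x - u y) ^ 2

/-- The second derivative of `graphSepSq u` at `(x, y)` in the direction `(a, b)`, for a function
`u` with gradient `g` and Hessian `H`. -/
noncomputable def graphSepSqHess (u : E → ℝ) (g : E → E) (H : E → E →L[ℝ] E) (x y a b : E) : ℝ :=
  2 * (⟪a - b, a - b⟫_ℝ - (⟪g x, a⟫_ℝ - ⟪g y, b⟫_ℝ) ^ 2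
    - (u x - u y) * (⟪H x a, a⟫_ℝ - ⟪H y b, b⟫_ℝ))

/-- The second derivative of `-c ^ (-κ)` along a curve with velocity `c'` and acceleration `c''`. -/
noncomputable def negRpowHess (κ c c' c'' : ℝ) : ℝ :=
  κ * c ^ (-κ - 1) * c'' - κ * (κ + 1) * c ^ (-κ - 2) * c' ^ 2

/-- The two-point function whose maximum is analysed, where `p` and `q` stand for the velocities
of the graph at `x` and `y`. -/
noncomputable def twoPoint (κ β δ : ℝ) (u : E → ℝ) (p q x y : E) : ℝ :=
  -lorentzCosh p q ^ (-κ) - β * graphSepSq u x y - δ * (graphSepSq u x 0 + graphSepSq u y 0)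

variable {ι : Type*} [Fintype ι] {e : OrthonormalBasis ι ℝ E} {u : E → ℝ} {g : E → E}
  {H : E → E →L[ℝ] E}

theorem hasDerivAt_neg_rpow {c c' : ℝ → ℝ} {t κ : ℝ} (hc : HasDerivAt c (c' t) t)
    (h0 : 0 < c t) :
    HasDerivAt (fun t => -c t ^ (-κ)) (κ * c t ^ (-κ - 1) * c' t) t := by
  refine (hc.rpow_const (Or.inl h0.ne')).neg.congr_deriv ?_
  ring

theorem hasDerivAt_neg_rpow_deriv {c c' : ℝ → ℝ} {c'' t κ : ℝ} (hc : HasDerivAt c (c' t) t)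
    (hc' : HasDerivAt c' c'' t) (h0 : 0 < c t) :
    HasDerivAt (fun t => κ * c t ^ (-κ - 1) * c' t) (negRpowHess κ (c t) (c' t) c'') t := by
  refine (((hc.rpow_const (p := -κ - 1) (Or.inl h0.ne')).const_mul κ).mul hc').congr_deriv ?_
  rw [negRpowHess, show -κ - 1 - 1 = -κ - 2 by ring]
  ring

namespace IsEntireMaximal

theorem hasDerivAt_graphSepSq (hu : IsEntireMaximal e u g H) (x y a b : E) (t : ℝ) :
    HasDerivAt (fun t : ℝ => graphSepSq u (x + t • a) (y + t • b))
      (2 * (⟪x + t • a - (y + t • b), a - b⟫_ℝ - (u (x + t • a) - u (y + t • b)) *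
        (⟪g (x + t • a), a⟫_ℝ - ⟪g (y + t • b), b⟫_ℝ))) t := by
  have h1 : ∀ x a : E, HasDerivAt (fun t : ℝ => x + t • a) a t := fun x a => by
    simpa using ((hasDerivAt_id t).smul_const a).const_add x
  refine (((h1 x a).sub (h1 y b)).norm_sq.sub
    (((hu.hasDerivAt_line a x t).sub (hu.hasDerivAt_line b y t)).pow 2)).congr_deriv ?_
  simp
  ring

theorem hasDerivAt_graphSepSq_deriv (hu : IsEntireMaximal e u g H) (x y a b : E) (t : ℝ) :
    HasDerivAt (fun t : ℝ => 2 * (⟪x + t • a - (y + t • b), a - b⟫_ℝ -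
        (u (x + t • a) - u (y + t • b)) * (⟪g (x + t • a), a⟫_ℝ - ⟪g (y + t • b), b⟫_ℝ)))
      (graphSepSqHess u g H (x + t • a) (y + t • b) a b) t := by
  have h1 : ∀ x a : E, HasDerivAt (fun t : ℝ => x + t • a) a t := fun x a => by
    simpa using ((hasDerivAt_id t).smul_const a).const_add x
  refine (((((h1 x a).sub (h1 y b)).inner ℝ (hasDerivAt_const t (a - b))).sub
    (((hu.hasDerivAt_line a x t).sub (hu.hasDerivAt_line b y t)).mul
      ((hu.hasDerivAt_grad_line a x t).sub (hu.hasDerivAt_grad_line b y t)))).const_mul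
        2).congr_deriv ?_
  simp only [graphSepSqHess, inner_zero_right, zero_add, Pi.sub_apply]
  ring

theorem second_deriv_twoPoint_nonpos (hu : IsEntireMaximal e u g H) {κ β δ h : ℝ} {x y : E}
    (a b : E) (hp : ‖gradQuot e u h x‖ < 1) (hq : ‖gradQuot e u h y‖ < 1)
    (hmax : IsLocalMax (fun z : E × E =>
      twoPoint κ β δ u (gradQuot e u h z.1) (gradQuot e u h z.2) z.1 z.2) (x, y)) :
    negRpowHess κ (lorentzCosh (gradQuot e u h x) (gradQuot e u h y))
      (⟪lorentzCoshGrad (gradQuot e u h x) (gradQuot e u h y),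
          gradQuot e (fun z => ⟪g z, a⟫_ℝ) h x⟫_ℝ
        + ⟪lorentzCoshGrad (gradQuot e u h y) (gradQuot e u h x),
          gradQuot e (fun z => ⟪g z, b⟫_ℝ) h y⟫_ℝ)
      (⟪lorentzCoshGrad (gradQuot e u h x) (gradQuot e u h y),
          gradQuot e (fun z => ⟪H z a, a⟫_ℝ) h x⟫_ℝ
        + ⟪lorentzCoshGrad (gradQuot e u h y) (gradQuot e u h x),
          gradQuot e (fun z => ⟪H z b, b⟫_ℝ) h y⟫_ℝ
        + lorentzCoshHess (gradQuot e u h x) (gradQuot e u h y)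
          (gradQuot e (fun z => ⟪g z, a⟫_ℝ) h x) (gradQuot e (fun z => ⟪g z, b⟫_ℝ) h y))
      - β * graphSepSqHess u g H x y a b
      - δ * (graphSepSqHess u g H x 0 a 0 + graphSepSqHess u g H y 0 b 0) ≤ 0 := by
  have hline : ∀ x a : E, Continuous fun t : ℝ => x + t • a := fun x a => by fun_prop
  have hcont := continuous_gradQuot (e := e) hu.continuous h
  have hP : ∀ a x : E, ∀ t : ℝ, HasDerivAt (fun t : ℝ => gradQuot e u h (x + t • a))
      (gradQuot e (fun z => ⟪g z, a⟫_ℝ) h (x + t • a)) t := fun a x t =>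
    hasDerivAt_gradQuot_line (fun y t => hu.hasDerivAt_line a y t) h x t
  have hP' : ∀ a x : E, ∀ t : ℝ, HasDerivAt
      (fun t : ℝ => gradQuot e (fun z => ⟪g z, a⟫_ℝ) h (x + t • a))
      (gradQuot e (fun z => ⟪H z a, a⟫_ℝ) h (x + t • a)) t := fun a x t =>
    hasDerivAt_gradQuot_line (f' := fun z => ⟪H z a, a⟫_ℝ)
      (fun y t => hu.hasDerivAt_grad_line a y t) h x t
  have hlt : ∀ a x : E, ‖gradQuot e u h x‖ < 1 →
      ∀ᶠ t in 𝓝 (0 : ℝ), ‖gradQuot e u h (x + t • a)‖ < 1 := fun a x hx => by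
    have h1 : ContinuousAt (fun t : ℝ => ‖gradQuot e u h (x + t • a)‖) 0 :=
      (hcont.comp (hline x a)).norm.continuousAt
    exact h1.eventually_lt continuousAt_const (by simpa using hx)
  set P : ℝ → E := fun t => gradQuot e u h (x + t • a) with hPdef
  set Q : ℝ → E := fun t => gradQuot e u h (y + t • b) with hQdef
  set P' : ℝ → E := fun t => gradQuot e (fun z => ⟪g z, a⟫_ℝ) h (x + t • a) with hP'def
  set Q' : ℝ → E := fun t => gradQuot e (fun z => ⟪g z, b⟫_ℝ) h (y + t • b) with hQ'def
  set S : E → E → E → E → ℝ → ℝ := fun x y a b t => 2 * (⟪x + t • a - (y + t • b), a - b⟫_ℝ -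
    (u (x + t • a) - u (y + t • b)) * (⟪g (x + t • a), a⟫_ℝ - ⟪g (y + t • b), b⟫_ℝ)) with hS
  set c : ℝ → ℝ := fun t => lorentzCosh (P t) (Q t) with hcdef
  set c' : ℝ → ℝ := fun t =>
    ⟪lorentzCoshGrad (P t) (Q t), P' t⟫_ℝ + ⟪lorentzCoshGrad (Q t) (P t), Q' t⟫_ℝ with hc'def
  have hc : ∀ t : ℝ, ‖P t‖ < 1 → ‖Q t‖ < 1 → HasDerivAt c (c' t) t :=
    fun t h1 h2 => hasDerivAt_lorentzCosh (hP a x t) (hP b y t) h1 h2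
  have hmax' : IsLocalMax (fun t : ℝ => -c t ^ (-κ)
      - β * graphSepSq u (x + t • a) (y + t • b)
      - δ * (graphSepSq u (x + t • a) (0 + t • 0) + graphSepSq u (y + t • b) (0 + t • 0))) 0 := by
    have h1 : ContinuousAt (fun t : ℝ => (x + t • a, y + t • b)) 0 :=
      ((hline x a).prodMk (hline y b)).continuousAt
    have h2 : (x + (0 : ℝ) • a, y + (0 : ℝ) • b) = (x, y) := by simp
    have h3 := IsLocalMax.comp_continuous (g := fun t : ℝ => (x + t • a, y + t • b))
      (f := fun z : E × E =>
        twoPoint κ β δ u (gradQuot e u h z.1) (gradQuot e u h z.2) z.1 z.2) (by rwa [h2]) h1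
    simpa only [Function.comp_def, twoPoint, smul_zero, add_zero] using h3
  have h1 : ∀ᶠ t in 𝓝 (0 : ℝ), HasDerivAt (fun t : ℝ => -c t ^ (-κ)
      - β * graphSepSq u (x + t • a) (y + t • b)
      - δ * (graphSepSq u (x + t • a) (0 + t • 0) + graphSepSq u (y + t • b) (0 + t • 0)))
      (κ * c t ^ (-κ - 1) * c' t - β * S x y a b t - δ * (S x 0 a 0 t + S y 0 b 0 t)) t := by
    filter_upwards [hlt a x hp, hlt b y hq] with t h1 h2
    exact ((hasDerivAt_neg_rpow (hc t h1 h2) (lorentzCosh_pos h1 h2)).sub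
      ((hu.hasDerivAt_graphSepSq x y a b t).const_mul β)).sub
      (((hu.hasDerivAt_graphSepSq x 0 a 0 t).add (hu.hasDerivAt_graphSepSq y 0 b 0 t)).const_mul δ)
  have h2 : HasDerivAt (fun t : ℝ =>
      κ * c t ^ (-κ - 1) * c' t - β * S x y a b t - δ * (S x 0 a 0 t + S y 0 b 0 t)) _ 0 :=
    ((hasDerivAt_neg_rpow_deriv (hc 0 (hlt a x hp).self_of_nhds (hlt b y hq).self_of_nhds)
      (hasDerivAt_inner_lorentzCoshGrad (hP a x 0) (hP b y 0) (hP' a x 0) (hP' b y 0)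
        (hlt a x hp).self_of_nhds (hlt b y hq).self_of_nhds)
      (lorentzCosh_pos (hlt a x hp).self_of_nhds (hlt b y hq).self_of_nhds)).sub
      ((hu.hasDerivAt_graphSepSq_deriv x y a b 0).const_mul β)).sub
      (((hu.hasDerivAt_graphSepSq_deriv x 0 a 0 0).add
        (hu.hasDerivAt_graphSepSq_deriv y 0 b 0 0)).const_mul δ)
  have h3 := second_deriv_nonpos_of_isLocalMax hmax' h1 h2
  simpa only [hcdef, hc'def, hPdef, hQdef, hP'def, hQ'def, zero_smul, add_zero] using h3

end IsEntireMaximal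

end Penalty

section Limit

variable {E : Type*} [NormedAddCommGroup E] [InnerProductSpace ℝ E]

@[fun_prop]
theorem continuousAt_lorentzFactor {p : E} (hp : ‖p‖ < 1) : ContinuousAt lorentzFactor p :=
  (hasStrictFDerivAt_lorentzFactor hp).continuousAt

theorem continuousAt_graphFrame {p : E} (hp : ‖p‖ < 1) (w : E) :
    ContinuousAt (fun p => graphFrame p w) p := by
  have hN : lorentzFactor p + 1 ≠ 0 := by linarith [lorentzFactor_pos hp]
  unfold graphFrame
  fun_prop (disch := assumption)

theorem continuousAt_lorentzCosh {p q : E} (hp : ‖p‖ < 1) (hq : ‖q‖ < 1) :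
    ContinuousAt (fun z : E × E => lorentzCosh z.1 z.2) (p, q) := by
  unfold lorentzCosh
  fun_prop (disch := assumption)

theorem continuousAt_lorentzCoshGrad {p q : E} (hp : ‖p‖ < 1) (hq : ‖q‖ < 1) :
    ContinuousAt (fun z : E × E => lorentzCoshGrad z.1 z.2) (p, q) := by
  unfold lorentzCoshGrad
  fun_prop (disch := assumption)

theorem continuousAt_lorentzCoshHess {p q : E} (hp : ‖p‖ < 1) (hq : ‖q‖ < 1) (ξ η : E) :
    ContinuousAt (fun z : E × E × E × E => lorentzCoshHess z.1 z.2.1 z.2.2.1 z.2.2.2)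
      (p, q, ξ, η) := by
  unfold lorentzCoshHess
  fun_prop (disch := assumption)

theorem sum_negRpowHess {ι : Type*} [Fintype ι] (κ c : ℝ) (c' c'' : ι → ℝ) :
    ∑ i, negRpowHess κ c (c' i) (c'' i) =
      κ * c ^ (-κ - 1) * ∑ i, c'' i - κ * (κ + 1) * c ^ (-κ - 2) * ∑ i, c' i ^ 2 := by
  simp only [negRpowHess, Finset.sum_sub_distrib, Finset.mul_sum]

variable {ι : Type*} [Fintype ι] {e : OrthonormalBasis ι ℝ E} {u : E → ℝ} {g : E → E}
  {H : E → E →L[ℝ] E}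

namespace IsEntireMaximal

theorem continuous_graphSepSqHess (hu : IsEntireMaximal e u g H) :
    Continuous fun z : E × E × E × E => graphSepSqHess u g H z.1 z.2.1 z.2.2.1 z.2.2.2 := by
  have h1 := hu.continuous
  have h2 := hu.continuous_grad
  have h3 := hu.continuous_hess
  unfold graphSepSqHess
  fun_prop

theorem sum_graphSepSqHess_coupled [DecidableEq ι] (hu : IsEntireMaximal e u g H) (o : ι)
    {x y : E} {b b' : OrthonormalBasis ι ℝ E} {c : ℝ}
    (hb : ∀ j k, ⟪graphFrame (g x) (b j), graphFrame (g y) (b' k)⟫_ℝ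
          - ⟪g x, graphFrame (g x) (b j)⟫_ℝ * ⟪g y, graphFrame (g y) (b' k)⟫_ℝ =
        if j = k then if k = o then c else 1 else 0) :
    ∑ i, graphSepSqHess u g H x y (graphFrame (g x) (b i)) (graphFrame (g y) (b' i)) =
      4 * (1 - c) := by
  simp only [graphSepSqHess]
  rw [← Finset.mul_sum, Finset.sum_sub_distrib,
    sum_coupled_frames o (hu.norm_grad_lt x) (hu.norm_grad_lt y) hb, ← Finset.mul_sum,
    Finset.sum_sub_distrib, hu.trace_graphFrame_eq_zero, hu.trace_graphFrame_eq_zero]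
  ring

theorem sum_graphSepSqHess_zero (hu : IsEntireMaximal e u g H) (x : E)
    (b : OrthonormalBasis ι ℝ E) :
    ∑ i, graphSepSqHess u g H x 0 (graphFrame (g x) (b i)) 0 = 2 * Fintype.card ι := by
  have h : ∀ i, ⟪graphFrame (g x) (b i), graphFrame (g x) (b i)⟫_ℝ
      - ⟪g x, graphFrame (g x) (b i)⟫_ℝ ^ 2 = 1 := fun i => by
    rw [sq, inner_graphFrame_sub (hu.norm_grad_lt x), real_inner_self_eq_norm_sq, b.norm_eq_one,
      one_pow]
  simp only [graphSepSqHess, sub_zero, inner_zero_right, h]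
  rw [← Finset.mul_sum, Finset.sum_sub_distrib, ← Finset.mul_sum, hu.trace_graphFrame_eq_zero]
  simp

theorem mul_lorentzCosh_sub_one_le [DecidableEq ι] [Nonempty ι] (hu : IsEntireMaximal e u g H)
    {β δ : ℝ} {α : Type*} {l : Filter α} [l.NeBot] {h : α → ℝ} {X Y : α → E} {x y : E}
    (hh : Tendsto h l (𝓝[≠] 0)) (hX : Tendsto X l (𝓝 x)) (hY : Tendsto Y l (𝓝 y))
    (hmax : ∀ᶠ a in l, IsLocalMax (fun z : E × E => twoPoint (1 / (2 * Fintype.card ι)) β δ u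
      (gradQuot e u (h a) z.1) (gradQuot e u (h a) z.2) z.1 z.2) (X a, Y a))
    (hne : g x ≠ g y) :
    β * (lorentzCosh (g x) (g y) - 1) ≤ δ * Fintype.card ι := by
  have : FiniteDimensional ℝ E := Module.Basis.finiteDimensional_of_finite e.toBasis
  have hp := hu.norm_grad_lt x
  have hq := hu.norm_grad_lt y
  obtain ⟨o⟩ := ‹Nonempty ι›
  obtain ⟨b, b', hb, hbo, hbo'⟩ := exists_coupled_frames
    (Module.finrank_eq_card_basis e.toBasis) o hp hq hne
  set κ : ℝ := 1 / (2 * Fintype.card ι) with hκ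
  have hκ0 : 0 ≤ κ := by positivity
  have hP := hu.tendsto_gradQuot hh hX
  have hQ := hu.tendsto_gradQuot hh hY
  have hA : ∀ i, Tendsto (fun a => graphFrame (g (X a)) (b i)) l (𝓝 (graphFrame (g x) (b i))) :=
    fun i => (continuousAt_graphFrame hp (b i)).tendsto.comp
      ((hu.continuous_grad.tendsto x).comp hX)
  have hB : ∀ i, Tendsto (fun a => graphFrame (g (Y a)) (b' i)) l (𝓝 (graphFrame (g y) (b' i))) :=
    fun i => (continuousAt_graphFrame hq (b' i)).tendsto.comp
      ((hu.continuous_grad.tendsto y).comp hY)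
  have hP' := fun i => hu.tendsto_gradQuot_grad hh hX (hA i)
  have hQ' := fun i => hu.tendsto_gradQuot_grad hh hY (hB i)
  have hR := hu.tendsto_gradQuot_hess hh hX b
  have hR' := hu.tendsto_gradQuot_hess hh hY b'
  have hc := (continuousAt_lorentzCosh hp hq).tendsto.comp (hP.prodMk_nhds hQ)
  have hG := (continuousAt_lorentzCoshGrad hp hq).tendsto.comp (hP.prodMk_nhds hQ)
  have hG' := (continuousAt_lorentzCoshGrad hq hp).tendsto.comp (hQ.prodMk_nhds hP)
  have hc0 := lorentzCosh_pos hp hq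
  have hL := ((hc.rpow_const (p := -κ - 1) (Or.inl hc0.ne')).const_mul κ).mul
    (((hG.inner (𝕜 := ℝ) hR).add (hG'.inner (𝕜 := ℝ) hR')).add
      (tendsto_finsetSum Finset.univ fun i _ =>
        (continuousAt_lorentzCoshHess hp hq _ _).tendsto.comp
          (hP.prodMk_nhds (hQ.prodMk_nhds ((hP' i).prodMk_nhds (hQ' i))))))
  have hΓ := ((hc.rpow_const (p := -κ - 2) (Or.inl hc0.ne')).const_mul (κ * (κ + 1))).mul
    (tendsto_finsetSum Finset.univ fun i _ =>
      ((hG.inner (𝕜 := ℝ) (hP' i)).add (hG'.inner (𝕜 := ℝ) (hQ' i))).pow 2)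
  have hS := (tendsto_finsetSum Finset.univ fun i _ =>
    (hu.continuous_graphSepSqHess.tendsto _).comp
      (hX.prodMk_nhds (hY.prodMk_nhds ((hA i).prodMk_nhds (hB i))))).const_mul β
  have hS0 := (tendsto_finsetSum Finset.univ fun i _ =>
    ((hu.continuous_graphSepSqHess.tendsto _).comp (hX.prodMk_nhds
      ((tendsto_const_nhds (x := (0 : E))).prodMk_nhds ((hA i).prodMk_nhds
        (tendsto_const_nhds (x := (0 : E))))))).add
    ((hu.continuous_graphSepSqHess.tendsto _).comp (hY.prodMk_nhds
      ((tendsto_const_nhds (x := (0 : E))).prodMk_nhds ((hB i).prodMk_nhds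
        (tendsto_const_nhds (x := (0 : E)))))))).const_mul δ
  have hlim := le_of_tendsto (((hL.sub hΓ).sub hS).sub hS0) (b := 0) (by
    filter_upwards [hmax, hP.norm.eventually_lt_const hp, hQ.norm.eventually_lt_const hq]
      with a ha h1 h2
    have h3 := Finset.sum_nonpos fun i (_ : i ∈ Finset.univ) => hu.second_deriv_twoPoint_nonpos
      (graphFrame (g (X a)) (b i)) (graphFrame (g (Y a)) (b' i)) h1 h2 ha
    rw [Finset.sum_sub_distrib, Finset.sum_sub_distrib, sum_negRpowHess, ← Finset.mul_sum,
      ← Finset.mul_sum, Finset.sum_add_distrib, Finset.sum_add_distrib, ← inner_sum,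
      ← inner_sum] at h3
    exact h3)
  have key := lorentzCosh_coupled_subharmonic o hp hq hb hbo hbo' (hu.symm x) (hu.symm y)
    (hu.trace_graphFrame_eq_zero x b) (hu.trace_graphFrame_eq_zero y b') rfl rfl
  dsimp only at hlim
  rw [hu.sum_graphSepSqHess_coupled o hb, Finset.sum_add_distrib, hu.sum_graphSepSqHess_zero,
    hu.sum_graphSepSqHess_zero] at hlim
  rw [← hκ] at key
  have hpow : lorentzCosh (g x) (g y) ^ (-κ - 1) =
      lorentzCosh (g x) (g y) ^ (-κ - 2) * lorentzCosh (g x) (g y) := by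
    rw [← Real.rpow_add_one hc0.ne']
    ring_nf
  rw [hpow] at hlim
  have h0 : 0 ≤ κ * lorentzCosh (g x) (g y) ^ (-κ - 2) := by positivity
  have := mul_le_mul_of_nonneg_left key h0
  linarith

end IsEntireMaximal

end Limit

theorem exists_tendsto_isLocalMax {α Z : Type*} [TopologicalSpace Z] {l : Filter α} [l.NeBot]
    {K : Set Z} (hK : IsCompact K) {F : α → Z → ℝ} {f : Z → ℝ}
    (hcont : ∀ᶠ a in l, ContinuousOn (F a) K)
    (hlim : ∀ l' ≤ l, ∀ (X : α → Z) (x : Z), Tendsto X l' (𝓝 x) →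
      Tendsto (fun a => F a (X a)) l' (𝓝 (f x)))
    {z₀ : Z} (hz₀ : z₀ ∈ K) (hlt : ∀ z ∈ K, z ∉ interior K → f z < f z₀) :
    ∃ l' ≤ l, l'.NeBot ∧ ∃ (X : α → Z) (x : Z), Tendsto X l' (𝓝 x) ∧
      (∀ᶠ a in l', IsLocalMax (F a) (X a)) ∧ ∀ z ∈ K, f z ≤ f x := by
  have h1 : ∀ a, ∃ x ∈ K, ContinuousOn (F a) K → IsMaxOn (F a) K x := fun a => by
    by_cases h : ContinuousOn (F a) K
    · obtain ⟨x, hx, hx'⟩ := hK.exists_isMaxOn ⟨z₀, hz₀⟩ h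
      exact ⟨x, hx, fun _ => hx'⟩
    · exact ⟨z₀, hz₀, fun h' => absurd h' h⟩
  choose X hXK hX using h1
  obtain ⟨x, hxK, hx⟩ := hK.ultrafilter_le_nhds ((Ultrafilter.of l).map X)
    (le_principal_iff.2 (Eventually.of_forall hXK : ∀ᶠ a in (Ultrafilter.of l : Filter α), X a ∈ K))
  have hle : ↑(Ultrafilter.of l) ≤ l := Ultrafilter.of_le l
  have hx : Tendsto X (Ultrafilter.of l) (𝓝 x) := hx
  have hmax : ∀ᶠ a in (Ultrafilter.of l : Filter α), IsMaxOn (F a) K (X a) :=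
    hle (hcont.mono fun a ha => hX a ha)
  have hfx : ∀ z ∈ K, f z ≤ f x := fun z hz =>
    le_of_tendsto_of_tendsto (hlim _ hle (fun _ => z) z tendsto_const_nhds) (hlim _ hle X x hx)
      (hmax.mono fun a ha => ha hz)
  refine ⟨_, hle, inferInstance, X, x, hx, ?_, hfx⟩
  have hxi : x ∈ interior K := by
    by_contra h
    exact (hlt x hxK h).not_ge (hfx z₀ hz₀)
  filter_upwards [hmax, hx (isOpen_interior.mem_nhds hxi)] with a ha ha'
  exact ha.isLocalMax (mem_interior_iff_mem_nhds.1 ha')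

section Rigidity

variable {E : Type*} [NormedAddCommGroup E] [InnerProductSpace ℝ E] {ι : Type*} [Fintype ι]
  {e : OrthonormalBasis ι ℝ E} {u : E → ℝ} {g : E → E} {H : E → E →L[ℝ] E}

namespace IsEntireMaximal

theorem abs_sub_le_norm_sub (hu : IsEntireMaximal e u g H) (x y : E) : |u x - u y| ≤ ‖x - y‖ := by
  have := Convex.norm_image_sub_le_of_norm_hasFDerivWithin_le (C := 1) (s := Set.univ)
    (fun z _ => (hu.hasFDerivAt z).hasFDerivWithinAt)
    (fun z _ => by rw [innerSL_apply_norm]; exact (hu.norm_grad_lt z).le) convex_univ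
    (Set.mem_univ y) (Set.mem_univ x)
  simpa using this

theorem graphSepSq_nonneg (hu : IsEntireMaximal e u g H) (x y : E) : 0 ≤ graphSepSq u x y := by
  rw [graphSepSq, sub_nonneg, ← sq_abs (u x - u y)]
  exact pow_le_pow_left₀ (abs_nonneg _) (hu.abs_sub_le_norm_sub x y) 2

theorem exists_mul_le_graphSepSq (hu : IsEntireMaximal e u g H) :
    ∃ ε > 0, ∀ x, ε * (‖x‖ - 1) ≤ graphSepSq u x 0 := by
  have : FiniteDimensional ℝ E := Module.Basis.finiteDimensional_of_finite e.toBasis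
  have : ProperSpace E := FiniteDimensional.proper ℝ E
  obtain ⟨z, hz, hmax⟩ := (isCompact_closedBall (0 : E) 1).exists_isMaxOn
    ⟨0, Metric.mem_closedBall_self zero_le_one⟩ hu.continuous_grad.norm.continuousOn
  have hk := hu.norm_grad_lt z
  have hk0 := norm_nonneg (g z)
  refine ⟨1 - ‖g z‖, sub_pos.2 hk, fun x => ?_⟩
  rcases le_total ‖x‖ 1 with hx | hx
  · exact (mul_nonpos_of_nonneg_of_nonpos (sub_nonneg.2 hk.le) (sub_nonpos.2 hx)).trans
      (hu.graphSepSq_nonneg x 0)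
  have hx0 : ‖x‖ ≠ 0 := by linarith
  set s : E := ‖x‖⁻¹ • x
  have hs : ‖s‖ = 1 := by rw [norm_smul, norm_inv, norm_norm, inv_mul_cancel₀ hx0]
  have h1 : |u s - u 0| ≤ ‖g z‖ := by
    have := Convex.norm_image_sub_le_of_norm_hasFDerivWithin_le (C := ‖g z‖)
      (fun w _ => (hu.hasFDerivAt w).hasFDerivWithinAt)
      (fun w hw => by rw [innerSL_apply_norm]; exact hmax hw) (convex_closedBall (0 : E) 1)
      (Metric.mem_closedBall_self zero_le_one) (by simp [hs] : s ∈ Metric.closedBall (0 : E) 1)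
    simpa [hs] using this
  have h2 : |u x - u s| ≤ ‖x‖ - 1 := by
    refine (hu.abs_sub_le_norm_sub x s).trans (le_of_eq ?_)
    have : x - s = (1 - ‖x‖⁻¹) • x := by rw [sub_smul, one_smul]
    rw [this, norm_smul, Real.norm_of_nonneg (sub_nonneg.2 (inv_le_one_of_one_le₀ hx)), sub_mul,
      inv_mul_cancel₀ hx0, one_mul]
  have h3 : |u x - u 0| ≤ ‖x‖ - (1 - ‖g z‖) := by
    have := abs_sub_le (u x) (u s) (u 0)
    linarith
  rw [graphSepSq, sub_zero, ← sq_abs (u x - u 0)]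
  have h4 := pow_le_pow_left₀ (abs_nonneg _) h3 2
  nlinarith

theorem eventually_norm_gradQuot_lt (hu : IsEntireMaximal e u g H) {K : Set E}
    (hK : IsCompact K) : ∀ᶠ h in 𝓝 (0 : ℝ), ∀ x ∈ K, ‖gradQuot e u h x‖ < 1 := by
  refine hK.eventually_forall_of_forall_eventually fun x _ => ?_
  have h1 : Tendsto (fun z : ℝ × E => gradQuot e u z.1 z.2) (𝓝[≠] 0 ×ˢ 𝓝 x) (𝓝 (g x)) :=
    hu.tendsto_gradQuot tendsto_fst tendsto_snd
  have h2 := h1.norm.eventually_lt_const (hu.norm_grad_lt x)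
  rw [← nhdsWithin_univ x, ← nhdsWithin_prod_eq, eventually_nhdsWithin_iff] at h2
  filter_upwards [h2] with z hz
  by_cases h0 : z.1 = 0
  · simp [gradQuot, h0]
  · exact hz ⟨h0, Set.mem_univ _⟩

theorem continuousOn_twoPoint_gradQuot (hu : IsEntireMaximal e u g H) (κ β δ : ℝ) {h : ℝ}
    {K : Set (E × E)} (hK : ∀ z ∈ K, ‖gradQuot e u h z.1‖ < 1 ∧ ‖gradQuot e u h z.2‖ < 1) :
    ContinuousOn (fun z : E × E =>
      twoPoint κ β δ u (gradQuot e u h z.1) (gradQuot e u h z.2) z.1 z.2) K := by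
  intro z hz
  have hc := continuous_gradQuot (e := e) hu.continuous h
  have h0 := hu.continuous
  have h1 : ContinuousAt
      (fun z : E × E => lorentzCosh (gradQuot e u h z.1) (gradQuot e u h z.2)) z :=
    ContinuousAt.comp (f := fun z : E × E => (gradQuot e u h z.1, gradQuot e u h z.2))
      (continuousAt_lorentzCosh (hK z hz).1 (hK z hz).2) (by fun_prop)
  have h2 := h1.rpow_const (p := -κ) (Or.inl (lorentzCosh_pos (hK z hz).1 (hK z hz).2).ne')
  unfold twoPoint graphSepSq
  exact ContinuousAt.continuousWithinAt (by fun_prop)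

theorem tendsto_twoPoint_gradQuot (hu : IsEntireMaximal e u g H) (κ β δ : ℝ) {l : Filter ℝ}
    (hl : l ≤ 𝓝[≠] 0) {Z : ℝ → E × E} {z : E × E} (hZ : Tendsto Z l (𝓝 z)) :
    Tendsto (fun h => twoPoint κ β δ u (gradQuot e u h (Z h).1) (gradQuot e u h (Z h).2)
      (Z h).1 (Z h).2) l (𝓝 (twoPoint κ β δ u (g z.1) (g z.2) z.1 z.2)) := by
  have hX : Tendsto (fun h => (Z h).1) l (𝓝 z.1) := (continuous_fst.tendsto z).comp hZ
  have hY : Tendsto (fun h => (Z h).2) l (𝓝 z.2) := (continuous_snd.tendsto z).comp hZ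
  have hh : Tendsto (fun h : ℝ => h) l (𝓝[≠] 0) := hl
  have hp := hu.norm_grad_lt z.1
  have hq := hu.norm_grad_lt z.2
  have hc := ((continuousAt_lorentzCosh hp hq).tendsto.comp
    ((hu.tendsto_gradQuot hh hX).prodMk_nhds (hu.tendsto_gradQuot hh hY))).rpow_const
      (p := -κ) (Or.inl (lorentzCosh_pos hp hq).ne')
  have hS : Continuous fun z : E × E => β * graphSepSq u z.1 z.2
      + δ * (graphSepSq u z.1 0 + graphSepSq u z.2 0) := by
    have h0 := hu.continuous
    unfold graphSepSq
    fun_prop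
  have h1 := hc.neg.sub ((hS.tendsto z).comp hZ)
  simp only [sub_add_eq_sub_sub] at h1
  exact h1.congr fun h => by simp only [Function.comp_apply, twoPoint]; ring

theorem twoPoint_le (hu : IsEntireMaximal e u g H) [Nonempty ι] {β δ : ℝ} (hβ : 0 < β)
    (hδ : 0 < δ) (x y : E) :
    twoPoint (1 / (2 * Fintype.card ι)) β δ u (g x) (g y) x y ≤
      -1 + δ * Fintype.card ι / β := by
  classical
  have : FiniteDimensional ℝ E := Module.Basis.finiteDimensional_of_finite e.toBasis
  have : ProperSpace E := FiniteDimensional.proper ℝ E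
  set κ : ℝ := 1 / (2 * Fintype.card ι) with hκ
  have hcard : (1 : ℝ) ≤ Fintype.card ι := by exact_mod_cast Fintype.card_pos
  have hκ0 : 0 ≤ κ := by positivity
  have hκ1 : κ ≤ 1 := by
    rw [hκ, div_le_one (by linarith)]
    linarith
  set f : E × E → ℝ := fun z => twoPoint κ β δ u (g z.1) (g z.2) z.1 z.2 with hf
  have hc := fun z : E × E => one_le_lorentzCosh (hu.norm_grad_lt z.1) (hu.norm_grad_lt z.2)
  obtain ⟨ε, hε, hεle⟩ := hu.exists_mul_le_graphSepSq
  obtain ⟨R, hR, hxyR⟩ : ∃ R : ℝ, 2 / (δ * ε) + 2 < R ∧ ‖(x, y)‖ ≤ R :=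
    ⟨max (2 / (δ * ε) + 3) ‖(x, y)‖, lt_max_of_lt_left (by linarith), le_max_right _ _⟩
  have hR0 : 0 < R := by
    have : 0 < 2 / (δ * ε) := by positivity
    linarith
  have hfar : ∀ z : E × E, R ≤ ‖z‖ → f z < -1 := fun z hz => by
    have h1 : ‖z‖ ≤ ‖z.1‖ + ‖z.2‖ := by
      rw [Prod.norm_def]
      exact max_le (by linarith [norm_nonneg z.2]) (by linarith [norm_nonneg z.1])
    have h2 : 2 < (δ * ε) * (R - 2) := by
      have := (div_lt_iff₀' (by positivity : 0 < δ * ε)).1 (by linarith : 2 / (δ * ε) < R - 2)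
      exact this
    have h3 : (δ * ε) * (R - 2) ≤ δ * (graphSepSq u z.1 0 + graphSepSq u z.2 0) := by
      rw [mul_assoc]
      refine mul_le_mul_of_nonneg_left ?_ hδ.le
      nlinarith [hεle z.1, hεle z.2]
    have h4 := mul_nonneg hβ.le (hu.graphSepSq_nonneg z.1 z.2)
    have h5 := Real.rpow_nonneg (zero_le_one.trans (hc z)) (-κ)
    simp only [hf, twoPoint]
    linarith
  have hf0 : -1 ≤ f 0 := by
    have h5 := Real.rpow_le_one_of_one_le_of_nonpos (hc 0) (neg_nonpos.2 hκ0)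
    simp only [hf, twoPoint, graphSepSq, Prod.fst_zero, Prod.snd_zero] at h5 ⊢
    simpa using h5
  have hK := isCompact_closedBall (0 : E × E) R
  obtain ⟨l, hl, hne, Z, z, hZ, hmax, hz⟩ := exists_tendsto_isLocalMax (l := 𝓝[≠] (0 : ℝ)) hK
    (F := fun h z => twoPoint κ β δ u (gradQuot e u h z.1) (gradQuot e u h z.2) z.1 z.2) (f := f)
    (by
      have h1 := hu.eventually_norm_gradQuot_lt (isCompact_closedBall (0 : E) R)
      filter_upwards [nhdsWithin_le_nhds h1] with h hh
      refine hu.continuousOn_twoPoint_gradQuot κ β δ fun z hz => ?_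
      rw [mem_closedBall_zero_iff] at hz
      exact ⟨hh _ (mem_closedBall_zero_iff.2 ((norm_fst_le z).trans hz)),
        hh _ (mem_closedBall_zero_iff.2 ((norm_snd_le z).trans hz))⟩)
    (fun l hl Z z hZ => hu.tendsto_twoPoint_gradQuot κ β δ hl hZ)
    (z₀ := 0) (Metric.mem_closedBall_self hR0.le)
    (fun z _ hz => by
      rw [interior_closedBall _ hR0.ne', mem_ball_zero_iff, not_lt] at hz
      exact (hfar z hz).trans_le hf0)
  refine (hz (x, y) (mem_closedBall_zero_iff.2 hxyR)).trans ?_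
  have hcz : lorentzCosh (g z.1) (g z.2) - 1 ≤ δ * Fintype.card ι / β := by
    by_cases hgz : g z.1 = g z.2
    · have h1 := lorentzFactor_sq_mul (hu.norm_grad_lt z.2)
      rw [lorentzCosh, hgz, ← sq, h1, sub_self]
      positivity
    · rw [le_div_iff₀' hβ]
      exact hu.mul_lorentzCosh_sub_one_le (l := l) (X := fun h => (Z h).1) (Y := fun h => (Z h).2)
        (h := fun h => h) hl
        ((continuous_fst.tendsto z).comp hZ) ((continuous_snd.tendsto z).comp hZ) hmax hgz
  have h1 : 2 - lorentzCosh (g z.1) (g z.2) ≤ lorentzCosh (g z.1) (g z.2) ^ (-κ) := by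
    refine le_trans ?_ (Real.rpow_le_rpow_of_exponent_le (hc z) (neg_le_neg hκ1))
    rw [Real.rpow_neg_one, ← one_div, le_div_iff₀ (by linarith [hc z])]
    nlinarith [sq_nonneg (lorentzCosh (g z.1) (g z.2) - 1)]
  have h2 := mul_nonneg hβ.le (hu.graphSepSq_nonneg z.1 z.2)
  have h3 := mul_nonneg hδ.le
    (add_nonneg (hu.graphSepSq_nonneg z.1 0) (hu.graphSepSq_nonneg z.2 0))
  simp only [hf, twoPoint]
  linarith

theorem grad_eq (hu : IsEntireMaximal e u g H) [Nonempty ι] (x y : E) : g x = g y := by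
  set κ : ℝ := 1 / (2 * Fintype.card ι) with hκ
  by_contra hne
  have hc := one_lt_lorentzCosh (hu.norm_grad_lt x) (hu.norm_grad_lt y) hne
  have hκ0 : 0 < κ := by
    have : (0 : ℝ) < Fintype.card ι := by exact_mod_cast Fintype.card_pos
    positivity
  have hlt := Real.rpow_lt_one_of_one_lt_of_neg hc (neg_neg_of_pos hκ0)
  have h1 : ∀ β > 0, 1 - lorentzCosh (g x) (g y) ^ (-κ) ≤ β * graphSepSq u x y := fun β hβ => by
    have h2 : Tendsto (fun δ : ℝ => β * graphSepSq u x y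
        + δ * (graphSepSq u x 0 + graphSepSq u y 0 + Fintype.card ι / β)) (𝓝[>] 0)
        (𝓝 (β * graphSepSq u x y)) := by
      refine Tendsto.mono_left ?_ nhdsWithin_le_nhds
      refine Continuous.tendsto' (by fun_prop) _ _ (by simp)
    refine ge_of_tendsto h2 (eventually_nhdsWithin_of_forall fun δ hδ => ?_)
    have h3 := hu.twoPoint_le hβ hδ x y
    rw [← hκ, twoPoint] at h3
    rw [mul_add, ← mul_div_assoc]
    linarith
  have h2 : Tendsto (fun β : ℝ => β * graphSepSq u x y) (𝓝[>] 0) (𝓝 0) := by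
    refine Tendsto.mono_left ?_ nhdsWithin_le_nhds
    exact Continuous.tendsto' (by fun_prop) _ _ (by simp)
  have h3 := ge_of_tendsto h2 (eventually_nhdsWithin_of_forall h1)
  linarith

theorem eq_inner_add (hu : IsEntireMaximal e u g H) [Nonempty ι] (x : E) :
    u x = ⟪g 0, x⟫_ℝ + u 0 := by
  have h1 : ∀ y, HasFDerivAt (fun y => u y - innerSL ℝ (g 0) y) (0 : E →L[ℝ] ℝ) y := fun y => by
    have := (hu.hasFDerivAt y).sub (innerSL ℝ (g 0)).hasFDerivAt
    rwa [hu.grad_eq y 0, sub_self] at this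
  have h2 := is_const_of_fderiv_eq_zero (𝕜 := ℝ) (fun y => (h1 y).differentiableAt)
    (fun y => (h1 y).fderiv) x 0
  simp only [innerSL_apply_apply, inner_zero_right] at h2
  linarith

end IsEntireMaximal

end Rigidity

theorem isEntireMaximal_of_contDiff {n : ℕ} {u : EuclideanSpace ℝ (Fin n) → ℝ}
    (hu : ContDiff ℝ 2 u) (hgrad : ∀ x, ‖gradient u x‖ < 1)
    (hmax : ∀ x, ∑ i, fderiv ℝ (fun y => gradient u y i / Real.sqrt (1 - ‖gradient u y‖ ^ 2)) x
      (EuclideanSpace.single i 1) = 0) :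
    IsEntireMaximal (EuclideanSpace.basisFun (Fin n) ℝ) u (gradient u) (fderiv ℝ (gradient u)) := by
  have hd : ContDiff ℝ 1 (fderiv ℝ u) := hu.fderiv_right (by norm_num)
  have hg : ContDiff ℝ 1 (gradient u) :=
    (InnerProductSpace.toDual ℝ (EuclideanSpace ℝ (Fin n))).symm.contDiff.comp hd
  have hgd : ∀ x, HasFDerivAt (gradient u) (fderiv ℝ (gradient u) x) x := fun x =>
    (hg.differentiable (by norm_num) x).hasFDerivAt
  have hsymm : ∀ x v w, ⟪fderiv ℝ (gradient u) x v, w⟫_ℝ = ⟪v, fderiv ℝ (gradient u) x w⟫_ℝ := by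
    intro x v w
    have hs : IsSymmSndFDerivAt ℝ u x := hu.contDiffAt.isSymmSndFDerivAt (by simp)
    have key : ∀ v w, fderiv ℝ (fderiv ℝ u) x v w = ⟪fderiv ℝ (gradient u) x v, w⟫_ℝ := by
      intro v w
      have h1 : fderiv ℝ u = fun y => innerSL ℝ (gradient u y) := by
        funext y
        exact ((hu.differentiable (by norm_num) y).hasGradientAt.hasFDerivAt).fderiv
      have h2 : HasFDerivAt (fun y => innerSL ℝ (gradient u y))
          ((innerSL ℝ).comp (fderiv ℝ (gradient u) x)) x :=
        (innerSL ℝ (E := EuclideanSpace ℝ (Fin n))).hasFDerivAt.comp x (hgd x)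
      rw [h1, h2.fderiv]
      rfl
    rw [← key, hs v w, key, real_inner_comm]
  refine ⟨fun x => (hu.differentiable (by norm_num) x).hasGradientAt.hasFDerivAt, hgd,
    hg.continuous_fderiv (by norm_num), hsymm, hgrad, fun x => ?_⟩
  have hF := ((hasStrictFDerivAt_lorentzFactor (hgrad x)).hasFDerivAt.comp x (hgd x)).smul (hgd x)
  have hN : 0 < lorentzFactor (gradient u x) := lorentzFactor_pos (hgrad x)
  have hterm : ∀ i : Fin n,
      fderiv ℝ (fun y => gradient u y i / Real.sqrt (1 - ‖gradient u y‖ ^ 2)) x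
        (EuclideanSpace.single i 1) =
      lorentzFactor (gradient u x) * fderiv ℝ (gradient u) x (EuclideanSpace.single i 1) i +
        lorentzFactor (gradient u x) ^ 3 *
          (gradient u x i * fderiv ℝ (gradient u) x (gradient u x) i) := by
    intro i
    have h1 := (EuclideanSpace.proj i : EuclideanSpace ℝ (Fin n) →L[ℝ] ℝ).hasFDerivAt.comp x hF
    have h2 : (fun y => gradient u y i / √(1 - ‖gradient u y‖ ^ 2)) =
        (EuclideanSpace.proj i : EuclideanSpace ℝ (Fin n) →L[ℝ] ℝ) ∘
          ((lorentzFactor ∘ gradient u) • gradient u) := by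
      funext y
      simp [lorentzFactor, div_eq_inv_mul]
    have h3 : ⟪gradient u x, fderiv ℝ (gradient u) x (EuclideanSpace.single i 1)⟫_ℝ =
        fderiv ℝ (gradient u) x (gradient u x) i := by
      rw [← hsymm, EuclideanSpace.inner_single_right]
      simp
    rw [h2, h1.fderiv]
    simp [h3]
    ring
  have h := hmax x
  simp only [hterm, Finset.sum_add_distrib, ← Finset.mul_sum] at h
  have h4 : ∑ i, gradient u x i * fderiv ℝ (gradient u) x (gradient u x) i =
      ⟪gradient u x, fderiv ℝ (gradient u) x (gradient u x)⟫_ℝ := by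
    simp only [PiLp.inner_apply, RCLike.inner_apply, conj_trivial, mul_comm]
  rw [h4] at h
  refine (mul_eq_zero.1 (?_ : lorentzFactor (gradient u x) * _ = 0)).resolve_left hN.ne'
  rw [← h]
  simp only [EuclideanSpace.basisFun_apply, EuclideanSpace.inner_single_left]
  simp
  ring

/-- **Cheng–Yau / Calabi–Bernstein theorem.** The only entire solutions of the maximal
hypersurface equation `div(∇u / √(1 - ‖∇u‖²)) = 0` on Euclidean space `ℝⁿ` with
`‖∇u‖ < 1` everywhere are the affine functions. -/
theorem cheng_yau_calabi_bernstein
    (n : ℕ) (hn : 1 ≤ n)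
    (u : EuclideanSpace ℝ (Fin n) → ℝ)
    (hu : ContDiff ℝ 2 u)
    (hgrad : ∀ x, ‖gradient u x‖ < 1)
    (hmax : ∀ x, ∑ i : Fin n,
      fderiv ℝ (fun y => gradient u y i / Real.sqrt (1 - ‖gradient u y‖ ^ 2)) x
        (EuclideanSpace.single i 1) = 0) :
    ∃ (ℓ : EuclideanSpace ℝ (Fin n) →ₗ[ℝ] ℝ) (c : ℝ), ∀ x, u x = ℓ x + c := by
  have : Nonempty (Fin n) := ⟨⟨0, hn⟩⟩
  exact ⟨(innerSL ℝ (gradient u 0)).toLinearMap, u 0,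
    (isEntireMaximal_of_contDiff hu hgrad hmax).eq_inner_add⟩
end

section
/- Let p, q ∈ V = ℝ × ℝⁿ and let c : [0,1] → V be a C¹ curve with c(0) = p, c(1) = q, such that for every t ∈ [0,1] the velocity c'(t) is future-directed causal, i.e. c'(t) ≠ 0 and Q(c'(t)) ≤ 0 with (c'(t))₀ > 0. Then the Lorentzian length of c satisfies ∫₀¹ √( ((c'(t))₀)² − ‖c'(t)̄‖² ) dt ≤ √( ((q−p)₀)² − ‖(q−p)̄‖² ). Moreover, the straight segment t ↦ p + t(q−p) (for q − p future-directed causal) is itself a future-directed causal curve from p to q whose Lorentzian length equals the right-hand side; hence the time separation d(p,q) in Minkowski space is finite and is realized by a causal geodesic (the Avez–Seifert property). -/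
open MeasureTheory in
/-- The reverse triangle inequality for integrals of causal vectors: the integral of the
Lorentzian lengths is at most the Lorentzian length of the integral. -/
theorem integral_sqrt_sq_sub_norm_sq_le {E : Type*} [NormedAddCommGroup E] [NormedSpace ℝ E]
    [CompleteSpace E] {a b : ℝ} (hab : a ≤ b) {u : ℝ → ℝ} {v : ℝ → E}
    (hu : ContinuousOn u (Set.Icc a b)) (hv : ContinuousOn v (Set.Icc a b))
    (huv : ∀ t ∈ Set.Icc a b, ‖v t‖ ≤ u t) :
    ∫ t in a..b, √(u t ^ 2 - ‖v t‖ ^ 2) ≤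
      √((∫ t in a..b, u t) ^ 2 - ‖∫ t in a..b, v t‖ ^ 2) := by
  set f : ℝ → ℝ := fun t => √(u t ^ 2 - ‖v t‖ ^ 2)
  have hf : ContinuousOn f (Set.Icc a b) := ((hu.pow 2).sub (hv.norm.pow 2)).sqrt
  let L := (WithLp.prodContinuousLinearEquiv 2 ℝ ℝ E).symm
  have hnorm : ∀ t ∈ Set.Icc a b, ‖L (f t, v t)‖ = u t := by
    intro t ht
    have h := huv t ht
    have h0 : 0 ≤ u t := (norm_nonneg _).trans h
    have h1 : 0 ≤ u t ^ 2 - ‖v t‖ ^ 2 := by nlinarith [norm_nonneg (v t)]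
    rw [← sq_eq_sq₀ (norm_nonneg _) h0, WithLp.prod_norm_sq_eq_of_L2]
    change ‖f t‖ ^ 2 + ‖v t‖ ^ 2 = u t ^ 2
    rw [Real.norm_eq_abs, sq_abs, Real.sq_sqrt h1]
    ring
  have hfi := hf.intervalIntegrable_of_Icc (μ := volume) hab
  have hvi := hv.intervalIntegrable_of_Icc (μ := volume) hab
  have hpi := (hf.prodMk hv).intervalIntegrable_of_Icc (μ := volume) hab
  have hpair : ∫ t in a..b, (f t, v t) = (∫ t in a..b, f t, ∫ t in a..b, v t) :=
    Prod.ext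
      ((ContinuousLinearMap.fst ℝ ℝ E).intervalIntegral_comp_comm hpi).symm
      ((ContinuousLinearMap.snd ℝ ℝ E).intervalIntegral_comp_comm hpi).symm
  have key : ‖L (∫ t in a..b, f t, ∫ t in a..b, v t)‖ ≤ ∫ t in a..b, u t := by
    have hcomm := L.toContinuousLinearMap.intervalIntegral_comp_comm hpi
    simp only [ContinuousLinearEquiv.coe_coe] at hcomm
    rw [← hpair, ← hcomm]
    refine (intervalIntegral.norm_integral_le_integral_norm hab).trans_eq
      (intervalIntegral.integral_congr fun t ht => ?_)
    exact hnorm t (by rwa [Set.uIcc_of_le hab] at ht)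
  have hsq := pow_le_pow_left₀ (norm_nonneg _) key 2
  rw [WithLp.prod_norm_sq_eq_of_L2] at hsq
  change ‖∫ t in a..b, f t‖ ^ 2 + ‖∫ t in a..b, v t‖ ^ 2 ≤ _ at hsq
  rw [Real.norm_eq_abs, sq_abs] at hsq
  exact Real.le_sqrt_of_sq_le (by linarith)


/-- **Avez–Seifert property in Minkowski space.** The Lorentzian length of any
future-directed causal `C¹` curve from `p` to `q` is at most
`√((q-p)₀² - ‖(q-p)̄‖²)`, and (when `q - p` is future-directed causal) the straight
segment from `p` to `q` is a future-directed causal curve realizing this value; hence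
the time separation `d(p,q)` is finite and realized by a causal geodesic. -/
theorem minkowski_avez_seifert
    (n : ℕ) (hn : 1 ≤ n)
    (p q : ℝ × EuclideanSpace ℝ (Fin n))
    (c : ℝ → ℝ × EuclideanSpace ℝ (Fin n))
    (c' : ℝ → ℝ × EuclideanSpace ℝ (Fin n))
    (hderiv : ∀ t ∈ Set.Icc (0:ℝ) 1, HasDerivAt c (c' t) t)
    (hc' : ContinuousOn c' (Set.Icc (0:ℝ) 1))
    (h0 : c 0 = p) (h1 : c 1 = q)
    (hcausal : ∀ t ∈ Set.Icc (0:ℝ) 1,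
      c' t ≠ 0 ∧ -((c' t).1 ^ 2) + ‖(c' t).2‖ ^ 2 ≤ 0 ∧ 0 < (c' t).1) :
    (∫ t in (0:ℝ)..1, Real.sqrt ((c' t).1 ^ 2 - ‖(c' t).2‖ ^ 2))
      ≤ Real.sqrt ((q.1 - p.1) ^ 2 - ‖q.2 - p.2‖ ^ 2) ∧
    ((q - p ≠ 0 ∧ -((q - p).1 ^ 2) + ‖(q - p).2‖ ^ 2 ≤ 0 ∧ 0 < (q - p).1) →
      ((fun s : ℝ => p + s • (q - p)) 0 = p ∧
       (fun s : ℝ => p + s • (q - p)) 1 = q ∧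
       (∀ t : ℝ, HasDerivAt (fun s : ℝ => p + s • (q - p)) (q - p) t) ∧
       (∫ t in (0:ℝ)..1, Real.sqrt ((q - p).1 ^ 2 - ‖(q - p).2‖ ^ 2))
         = Real.sqrt ((q.1 - p.1) ^ 2 - ‖q.2 - p.2‖ ^ 2))) := by
  have hIcc : Set.uIcc (0 : ℝ) 1 = Set.Icc 0 1 := Set.uIcc_of_le zero_le_one
  refine ⟨?_, fun _ => ⟨by simp, by simp, fun t => ?_, by simp⟩⟩
  · have hu := hc'.fst
    have hv := hc'.snd
    have hfst : ∫ t in (0 : ℝ)..1, (c' t).1 = q.1 - p.1 := by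
      rw [← h0, ← h1]
      refine intervalIntegral.integral_eq_sub_of_hasDerivAt (f := fun t => (c t).1)
        (fun t ht => ?_) (hu.intervalIntegrable_of_Icc zero_le_one)
      exact (hderiv t (hIcc ▸ ht)).fst
    have hsnd : ∫ t in (0 : ℝ)..1, (c' t).2 = q.2 - p.2 := by
      rw [← h0, ← h1]
      refine intervalIntegral.integral_eq_sub_of_hasDerivAt (f := fun t => (c t).2)
        (fun t ht => ?_) (hv.intervalIntegrable_of_Icc zero_le_one)
      exact (hderiv t (hIcc ▸ ht)).snd
    rw [← hfst, ← hsnd]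
    refine integral_sqrt_sq_sub_norm_sq_le zero_le_one hu hv fun t ht => ?_
    obtain ⟨-, hle, hpos⟩ := hcausal t ht
    exact (abs_le_of_sq_le_sq' (by linarith) hpos.le).2
  · simpa using ((hasDerivAt_id t).smul_const (q - p)).const_add p
end
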